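/- Consider smooth solutions of Δ²u = 6e^{4u} on the open unit ball B₁ ⊂ ℝ⁴, smooth up to the boundary, with u = 0 and ∂_ν u = −1 on ∂B₁. Then: (i) there are at most two such solutions; (ii) u_s(x) = ln(2/(1+|x|²)) is the minimal solution, i.e. u_s is a solution and every solution u satisfies u ≥ u_s on B₁. -/

import Mathlib

open Metric Real

/-- The Euclidean Laplacian of a function on `ℝⁿ`, as the sum of pure second
derivatives in the coordinate directions. -/
noncomputable def laplacian {n : ℕ} (u : EuclideanSpace ℝ (Fin n) → ℝ)
    (x : EuclideanSpace ℝ (Fin n)) : ℝ :=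
  ∑ i : Fin n, iteratedFDeriv ℝ 2 u x ![EuclideanSpace.single i 1, EuclideanSpace.single i 1]

/-- `u` is a smooth solution of `Δ²u = 6e^{4u}` on the unit ball of `ℝ⁴` with
`u = 0` and `∂_ν u = -1` on the unit sphere. -/
def IsSol4 (u : EuclideanSpace ℝ (Fin 4) → ℝ) : Prop :=
  ContDiff ℝ (⊤ : ℕ∞) u ∧
  (∀ x ∈ ball (0 : EuclideanSpace ℝ (Fin 4)) 1,
    laplacian (laplacian u) x = 6 * Real.exp (4 * u x)) ∧
  (∀ x ∈ sphere (0 : EuclideanSpace ℝ (Fin 4)) 1, u x = 0) ∧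
  (∀ x ∈ sphere (0 : EuclideanSpace ℝ (Fin 4)) 1, fderiv ℝ u x x = -1)

open scoped Topology
open MeasureTheory

section LaplacianCalculus

variable {n : ℕ} {f g q u : EuclideanSpace ℝ (Fin n) → ℝ} {x : EuclideanSpace ℝ (Fin n)}

/-- The `i`-th partial derivative. -/
noncomputable abbrev pderiv (i : Fin n) (u : EuclideanSpace ℝ (Fin n) → ℝ)
    (x : EuclideanSpace ℝ (Fin n)) : ℝ :=
  fderiv ℝ u x (EuclideanSpace.single i 1)

lemma ContDiffAt.differentiableAt_pderiv (hu : ContDiffAt ℝ 2 u x) (i : Fin n) :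
    DifferentiableAt ℝ (pderiv i u) x := by
  have h : ContDiffAt ℝ 1 (fderiv ℝ u) x := hu.fderiv_right (by norm_num)
  exact (h.differentiableAt (by norm_num)).clm_apply (differentiableAt_const _)

lemma ContDiffAt.eventually_differentiableAt_of_two (hu : ContDiffAt ℝ 2 u x) :
    ∀ᶠ y in 𝓝 x, DifferentiableAt ℝ u y := by
  filter_upwards [hu.eventually (by simp)] with y hy using hy.differentiableAt (by norm_num)

lemma laplacian_eq_sum_pderiv (hu : ContDiffAt ℝ 2 u x) :
    laplacian u x = ∑ i, pderiv i (pderiv i u) x := by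
  have h : ContDiffAt ℝ 1 (fderiv ℝ u) x := hu.fderiv_right (by norm_num)
  have h := h.differentiableAt (by norm_num)
  unfold laplacian
  refine Finset.sum_congr rfl fun i _ => ?_
  rw [iteratedFDeriv_two_apply, pderiv]
  change _ = fderiv ℝ (fun y => fderiv ℝ u y (EuclideanSpace.single i 1)) x _
  rw [fderiv_clm_apply h (differentiableAt_const _)]
  simp

lemma laplacian_congr (h : f =ᶠ[𝓝 x] g) : laplacian f x = laplacian g x := by
  unfold laplacian
  rw [Filter.EventuallyEq.eq_of_nhds (h.iteratedFDeriv ℝ 2)]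

lemma laplacian_add (hf : ContDiffAt ℝ 2 f x) (hg : ContDiffAt ℝ 2 g x) :
    laplacian (fun y => f y + g y) x = laplacian f x + laplacian g x := by
  unfold laplacian
  rw [← Finset.sum_add_distrib]
  refine Finset.sum_congr rfl fun i _ => ?_
  have := iteratedFDeriv_add_apply (i := 2) (x := x) hf hg
  rw [show (fun y => f y + g y) = f + g from rfl, this]; rfl

lemma laplacian_const_mul (c : ℝ) (hf : ContDiffAt ℝ 2 f x) :
    laplacian (fun y => c * f y) x = c * laplacian f x := by
  unfold laplacian
  rw [Finset.mul_sum]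
  refine Finset.sum_congr rfl fun i _ => ?_
  have := iteratedFDeriv_const_smul_apply (i := 2) (x := x) (a := c) hf
  rw [show (fun y => c * f y) = c • f from rfl, this]; rfl

lemma laplacian_sub (hf : ContDiffAt ℝ 2 f x) (hg : ContDiffAt ℝ 2 g x) :
    laplacian (fun y => f y - g y) x = laplacian f x - laplacian g x := by
  have := laplacian_add hf (contDiffAt_const.mul hg : ContDiffAt ℝ 2 (fun y => (-1) * g y) x)
  rw [laplacian_const_mul _ hg] at this
  simpa [sub_eq_add_neg] using this

lemma laplacian_const (c : ℝ) : laplacian (fun _ => c) x = 0 := by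
  rw [laplacian_eq_sum_pderiv contDiffAt_const]
  have h : ∀ i : Fin n, pderiv i (fun _ : EuclideanSpace ℝ (Fin n) => c) = fun _ => 0 := by
    intro i; funext y; simp [pderiv]
  simp only [h]
  simp [pderiv]

lemma laplacian_mul (hf : ContDiffAt ℝ 2 f x) (hg : ContDiffAt ℝ 2 g x) :
    laplacian (fun y => f y * g y) x =
      f x * laplacian g x + 2 * ∑ i, pderiv i f x * pderiv i g x + g x * laplacian f x := by
  rw [laplacian_eq_sum_pderiv (hf.mul hg), laplacian_eq_sum_pderiv hf,
    laplacian_eq_sum_pderiv hg, Finset.mul_sum, Finset.mul_sum, Finset.mul_sum,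
    ← Finset.sum_add_distrib, ← Finset.sum_add_distrib]
  refine Finset.sum_congr rfl fun i _ => ?_
  have h1 : pderiv i (fun y => f y * g y) =ᶠ[𝓝 x]
      fun y => f y * pderiv i g y + g y * pderiv i f y := by
    filter_upwards [hf.eventually_differentiableAt_of_two,
      hg.eventually_differentiableAt_of_two] with y h1 h2
    rw [pderiv, fderiv_fun_mul h1 h2]; simp
  have hf1 := hf.differentiableAt (by norm_num)
  have hg1 := hg.differentiableAt (by norm_num)
  have hf2 := hf.differentiableAt_pderiv i
  have hg2 := hg.differentiableAt_pderiv i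
  have h2 := ((hf1.hasFDerivAt.mul hg2.hasFDerivAt).add
    (hg1.hasFDerivAt.mul hf2.hasFDerivAt)).fderiv
  rw [pderiv, h1.fderiv_eq]
  change fderiv ℝ (f * pderiv i g + g * pderiv i f) x _ = _
  rw [h2]
  simp
  ring

lemma laplacian_comp {h h' : ℝ → ℝ} {h'' : ℝ} (hh : ContDiffAt ℝ 2 h (q x))
    (hd : ∀ᶠ z in 𝓝 (q x), HasDerivAt h (h' z) z) (hd' : HasDerivAt h' h'' (q x))
    (hq : ContDiffAt ℝ 2 q x) :
    laplacian (fun y => h (q y)) x =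
      h'' * ∑ i, pderiv i q x ^ 2 + h' (q x) * laplacian q x := by
  rw [laplacian_eq_sum_pderiv (u := fun y => h (q y)) (hh.comp x hq),
    laplacian_eq_sum_pderiv hq, Finset.mul_sum, Finset.mul_sum, ← Finset.sum_add_distrib]
  refine Finset.sum_congr rfl fun i _ => ?_
  have h1 : pderiv i (fun y => h (q y)) =ᶠ[𝓝 x] fun y => h' (q y) * pderiv i q y := by
    filter_upwards [hq.continuousAt.eventually hd,
      hq.eventually_differentiableAt_of_two] with y h1 h2
    have := (h1.comp_hasFDerivAt y h2.hasFDerivAt).fderiv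
    rw [pderiv]
    change fderiv ℝ (h ∘ q) y _ = _
    rw [this]; simp
  have hq1 := hq.differentiableAt (by norm_num)
  have hq2 := hq.differentiableAt_pderiv i
  have hc := hd'.comp_hasFDerivAt x hq1.hasFDerivAt
  have := (hc.mul hq2.hasFDerivAt).fderiv
  rw [pderiv, h1.fderiv_eq]
  change fderiv ℝ ((h' ∘ q) * (pderiv i q)) x _ = _
  rw [this]
  simp
  ring

lemma ContDiffAt.laplacian {m k : WithTop ℕ∞} (hu : ContDiffAt ℝ k u x) (hk : m + 2 ≤ k) :
    ContDiffAt ℝ m (laplacian u) x := by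
  have h2 : (1 : WithTop ℕ∞) + 1 = 2 := by norm_num
  have hk' : (m + 1) + 1 ≤ k := by rwa [add_assoc, h2]
  have h1 : ContDiffAt ℝ m (fderiv ℝ (fderiv ℝ u)) x :=
    (hu.fderiv_right hk').fderiv_right le_rfl
  have : _root_.laplacian u = fun y => ∑ i : Fin n, fderiv ℝ (fderiv ℝ u) y
      (EuclideanSpace.single i 1) (EuclideanSpace.single i 1) := by
    funext y
    simp [_root_.laplacian, iteratedFDeriv_two_apply]
  rw [this]
  exact ContDiffAt.sum fun i _ => (h1.clm_apply contDiffAt_const).clm_apply contDiffAt_const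

end LaplacianCalculus

/-- The quadratic function `α‖y‖² - 2⟪β, y⟫ + γ`. -/
noncomputable def quad (α : ℝ) (β : EuclideanSpace ℝ (Fin 4)) (γ : ℝ)
    (y : EuclideanSpace ℝ (Fin 4)) : ℝ :=
  α * ‖y‖ ^ 2 - 2 * inner ℝ β y + γ

section Quad

variable {α γ : ℝ} {β y : EuclideanSpace ℝ (Fin 4)}

lemma contDiff_quad {k : WithTop ℕ∞} : ContDiff ℝ k (quad α β γ) := by
  unfold quad
  exact ((contDiff_const.mul (contDiff_norm_sq ℝ)).sub
    (contDiff_const.mul (contDiff_const.inner ℝ contDiff_id))).add contDiff_const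

lemma pderiv_quad (i : Fin 4) : pderiv i (quad α β γ) y = 2 * (α * y i - β i) := by
  have h1 : HasFDerivAt (fun y : EuclideanSpace ℝ (Fin 4) => ‖y‖ ^ 2) (2 • (innerSL ℝ y)) y :=
    (hasStrictFDerivAt_norm_sq y).hasFDerivAt
  have h2 : HasFDerivAt (fun y : EuclideanSpace ℝ (Fin 4) => inner ℝ β y) (innerSL ℝ β) y :=
    (innerSL ℝ β).hasFDerivAt
  have h3 := (((h1.const_mul α).sub (h2.const_mul 2)).add_const γ).fderiv
  rw [pderiv]
  change fderiv ℝ (fun y => α * ‖y‖ ^ 2 - 2 * inner ℝ β y + γ) y _ = _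
  refine (congrArg (fun l => l (EuclideanSpace.single i 1)) h3).trans ?_
  simp [EuclideanSpace.inner_single_right]
  ring

lemma laplacian_quad : laplacian (quad α β γ) y = 8 * α := by
  rw [laplacian_eq_sum_pderiv contDiff_quad.contDiffAt]
  have h : ∀ i : Fin 4, pderiv i (pderiv i (quad α β γ)) y = 2 * α := by
    intro i
    have : pderiv i (quad α β γ) = fun y => 2 * (α * y i - β i) := by
      funext y; exact pderiv_quad i
    rw [this, pderiv]
    have h1 : HasFDerivAt (fun y : EuclideanSpace ℝ (Fin 4) => y i)
        (EuclideanSpace.proj i : EuclideanSpace ℝ (Fin 4) →L[ℝ] ℝ) y :=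
      (EuclideanSpace.proj i : EuclideanSpace ℝ (Fin 4) →L[ℝ] ℝ).hasFDerivAt
    have h3 := (((h1.const_mul α).sub_const (β i)).const_mul 2).fderiv
    refine (congrArg (fun l => l (EuclideanSpace.single i 1)) h3).trans ?_
    simp
  simp only [h]
  simp
  ring

lemma sum_pderiv_quad_mul {α' γ' : ℝ} {β' : EuclideanSpace ℝ (Fin 4)} :
    ∑ i, pderiv i (quad α β γ) y * pderiv i (quad α' β' γ') y =
      4 * (α * α' * ‖y‖ ^ 2 - α * inner ℝ β' y - α' * inner ℝ β y + inner ℝ β β') := by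
  simp only [pderiv_quad]
  rw [EuclideanSpace.norm_sq_eq]
  simp only [PiLp.inner_apply, Fin.sum_univ_four]
  simp
  ring

lemma sum_pderiv_quad_sq : ∑ i, pderiv i (quad α β γ) y ^ 2 =
    4 * (α * quad α β γ y - (α * γ - ‖β‖ ^ 2)) := by
  simp only [pow_two (pderiv _ _ _)]
  rw [sum_pderiv_quad_mul, real_inner_self_eq_norm_sq, quad]
  ring

lemma laplacian_comp_quad {h h' : ℝ → ℝ} {h'' : ℝ} (hh : ContDiffAt ℝ 2 h (quad α β γ y))
    (hd : ∀ᶠ z in 𝓝 (quad α β γ y), HasDerivAt h (h' z) z)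
    (hd' : HasDerivAt h' h'' (quad α β γ y)) :
    laplacian (fun y => h (quad α β γ y)) y =
      4 * (α * quad α β γ y - (α * γ - ‖β‖ ^ 2)) * h'' + 8 * α * h' (quad α β γ y) := by
  rw [laplacian_comp hh hd hd' contDiff_quad.contDiffAt, sum_pderiv_quad_sq, laplacian_quad]
  ring

lemma laplacian_log_quad (hy : quad α β γ y ≠ 0) :
    laplacian (fun y => log (quad α β γ y)) y =
      4 * α * (quad α β γ y)⁻¹ + 4 * (α * γ - ‖β‖ ^ 2) * (quad α β γ y ^ 2)⁻¹ := by
  rw [laplacian_comp_quad (h' := fun z => z⁻¹) (contDiffAt_log.2 hy)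
    (by filter_upwards [isOpen_ne.mem_nhds hy] with z hz using hasDerivAt_log hz)
    (hasDerivAt_inv hy)]
  field_simp
  ring

lemma hasDerivAt_inv_pow (k : ℕ) {z : ℝ} (hz : z ≠ 0) :
    HasDerivAt (fun z : ℝ => (z ^ k)⁻¹) (-k * (z ^ (k + 1))⁻¹) z := by
  refine ((hasDerivAt_pow k z).fun_inv (pow_ne_zero k hz)).congr_deriv ?_
  rcases k with _ | k
  · simp
  · simp only [Nat.cast_add, Nat.cast_one, add_tsub_cancel_right]
    field_simp
    ring

lemma laplacian_inv_pow_quad (k : ℕ) (hy : quad α β γ y ≠ 0) :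
    laplacian (fun y => (quad α β γ y ^ k)⁻¹) y =
      4 * k * (k - 1) * α * (quad α β γ y ^ (k + 1))⁻¹ -
        4 * k * (k + 1) * (α * γ - ‖β‖ ^ 2) * (quad α β γ y ^ (k + 2))⁻¹ := by
  rw [laplacian_comp_quad (h := fun z => (z ^ k)⁻¹) (h' := fun z => -k * (z ^ (k + 1))⁻¹)
    ((contDiffAt_id.pow k).inv (pow_ne_zero k hy))
    (by filter_upwards [isOpen_ne.mem_nhds hy] with z hz using hasDerivAt_inv_pow k hz)
    ((hasDerivAt_inv_pow (k + 1) hy).const_mul _)]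
  push_cast
  field_simp
  ring

end Quad

section Green

variable {n : ℕ}

lemma ContDiffAt.pderiv {u : EuclideanSpace ℝ (Fin n) → ℝ} {x : EuclideanSpace ℝ (Fin n)}
    {m k : WithTop ℕ∞} (hu : ContDiffAt ℝ k u x) (hk : m + 1 ≤ k) (i : Fin n) :
    ContDiffAt ℝ m (pderiv i u) x :=
  (hu.fderiv_right hk).clm_apply contDiffAt_const

lemma lipschitzWith_indicator_closedBall {F : EuclideanSpace ℝ (Fin n) → ℝ} {C : NNReal}
    (hF : LipschitzOnWith C F (closedBall 0 1)) (h0 : ∀ x ∈ sphere 0 1, F x = 0) :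
    LipschitzWith C ((closedBall 0 1).indicator F) := by
  have key : ∀ p ∈ closedBall (0 : EuclideanSpace ℝ (Fin n)) 1,
      ∀ q ∉ closedBall (0 : EuclideanSpace ℝ (Fin n)) 1, |F p| ≤ C * dist p q := by
    intro p hp q hq
    rw [mem_closedBall_zero_iff] at hp hq
    have hcont : ContinuousOn (fun s : ℝ => ‖p + s • (q - p)‖) (Set.Icc 0 1) := by fun_prop
    obtain ⟨s, hs, hs1⟩ := intermediate_value_Icc zero_le_one hcont
      (show (1 : ℝ) ∈ Set.Icc _ _ by simp; exact ⟨hp, (not_le.1 hq).le⟩)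
    have hr : p + s • (q - p) ∈ sphere (0 : EuclideanSpace ℝ (Fin n)) 1 := by simpa using hs1
    have h1 := hF.dist_le_mul p (by simpa using hp) _ (sphere_subset_closedBall hr)
    rw [h0 _ hr, Real.dist_eq, sub_zero] at h1
    refine h1.trans (mul_le_mul_of_nonneg_left ?_ C.2)
    rw [dist_self_add_right, norm_smul, dist_eq_norm, norm_sub_rev q p, Real.norm_eq_abs,
      abs_of_nonneg hs.1]
    exact mul_le_of_le_one_left (norm_nonneg _) hs.2
  refine LipschitzWith.of_dist_le_mul fun p q => ?_
  by_cases hp : p ∈ closedBall (0 : EuclideanSpace ℝ (Fin n)) 1 <;>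
    by_cases hq : q ∈ closedBall (0 : EuclideanSpace ℝ (Fin n)) 1
  · simpa [hp, hq] using hF.dist_le_mul p hp q hq
  · rw [Set.indicator_of_mem hp, Set.indicator_of_notMem hq, Real.dist_eq, sub_zero]
    exact key p hp q hq
  · rw [Set.indicator_of_mem hq, Set.indicator_of_notMem hp, Real.dist_eq, zero_sub, abs_neg,
      dist_comm]
    exact key q hq p hp
  · rw [Set.indicator_of_notMem hq, Set.indicator_of_notMem hp, dist_self]
    positivity

lemma exists_lipschitzOnWith_closedBall {F : EuclideanSpace ℝ (Fin n) → ℝ}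
    (hF : ∀ x ∈ closedBall (0 : EuclideanSpace ℝ (Fin n)) 1, ContDiffAt ℝ 1 F x) :
    ∃ C : NNReal, LipschitzOnWith C F (closedBall 0 1) := by
  have hc : ContinuousOn (fderiv ℝ F) (closedBall 0 1) := fun x hx =>
    ((hF x hx).continuousAt_fderiv (by norm_num)).continuousWithinAt
  obtain ⟨C, hC⟩ := (isCompact_closedBall (0 : EuclideanSpace ℝ (Fin n)) 1).exists_bound_of_continuousOn hc
  refine ⟨C.toNNReal, (convex_closedBall 0 1).lipschitzOnWith_of_nnnorm_fderiv_le
    (fun x hx => (hF x hx).differentiableAt (by norm_num)) fun x hx => ?_⟩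
  rw [← NNReal.coe_le_coe, coe_nnnorm]
  exact (hC x hx).trans (le_max_left _ _)

lemma integral_ball_fderiv_eq_zero {F : EuclideanSpace ℝ (Fin n) → ℝ}
    (hF : ∀ x ∈ closedBall (0 : EuclideanSpace ℝ (Fin n)) 1, ContDiffAt ℝ 1 F x)
    (h0 : ∀ x ∈ sphere (0 : EuclideanSpace ℝ (Fin n)) 1, F x = 0)
    (v : EuclideanSpace ℝ (Fin n)) :
    ∫ x in ball (0 : EuclideanSpace ℝ (Fin n)) 1, fderiv ℝ F x v = 0 := by
  obtain ⟨C, hC⟩ := exists_lipschitzOnWith_closedBall hF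
  have hL := lipschitzWith_indicator_closedBall hC h0
  have hsupp : HasCompactSupport
      ((closedBall (0 : EuclideanSpace ℝ (Fin n)) 1).indicator F) :=
    HasCompactSupport.intro (isCompact_closedBall 0 1) fun x hx => Set.indicator_of_notMem hx F
  have h := LipschitzWith.integral_lineDeriv_mul_eq (μ := volume)
    (LipschitzWith.const (1 : ℝ) : LipschitzWith 0 (fun _ : EuclideanSpace ℝ (Fin n) => (1 : ℝ)))
    hL hsupp (-v)
  simp only [neg_neg, mul_one] at h
  have hz : ∀ x : EuclideanSpace ℝ (Fin n),
      lineDeriv ℝ (fun _ : EuclideanSpace ℝ (Fin n) => (1 : ℝ)) x (-v) = 0 := by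
    intro x; simp [lineDeriv]
  simp only [hz, zero_mul, integral_zero] at h
  rw [h, ← integral_indicator measurableSet_ball]
  refine integral_congr_ae ?_
  have hs : ∀ᵐ x ∂(volume : Measure (EuclideanSpace ℝ (Fin n))), x ∉ sphere (0 : EuclideanSpace ℝ (Fin n)) 1 :=
    measure_eq_zero_iff_ae_notMem.1 (Measure.addHaar_sphere_of_ne_zero _ _ one_ne_zero)
  filter_upwards [hs] with x hx
  by_cases hb : x ∈ ball (0 : EuclideanSpace ℝ (Fin n)) 1
  · rw [Set.indicator_of_mem hb]
    have he : (closedBall (0 : EuclideanSpace ℝ (Fin n)) 1).indicator F =ᶠ[𝓝 x] F := by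
      filter_upwards [isOpen_ball.mem_nhds hb] with y hy
      exact Set.indicator_of_mem (ball_subset_closedBall hy) F
    rw [he.lineDeriv_eq, ((hF x (ball_subset_closedBall hb)).differentiableAt
      (by norm_num)).lineDeriv_eq_fderiv]
  · rw [Set.indicator_of_notMem hb]
    have hcb : x ∈ (closedBall (0 : EuclideanSpace ℝ (Fin n)) 1)ᶜ := by
      intro h1
      rw [← ball_union_sphere] at h1
      exact h1.elim hb hx
    have he : (closedBall (0 : EuclideanSpace ℝ (Fin n)) 1).indicator F =ᶠ[𝓝 x] fun _ => 0 := by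
      filter_upwards [isClosed_closedBall.isOpen_compl.mem_nhds hcb] with y hy
      exact Set.indicator_of_notMem hy F
    rw [he.lineDeriv_eq]
    simp [lineDeriv]

lemma integrableOn_ball_of_continuousAt {F : EuclideanSpace ℝ (Fin n) → ℝ}
    (hF : ∀ x ∈ closedBall (0 : EuclideanSpace ℝ (Fin n)) 1, ContinuousAt F x) :
    IntegrableOn F (ball 0 1) :=
  ((ContinuousOn.integrableOn_compact (isCompact_closedBall 0 1)
    fun x hx => (hF x hx).continuousWithinAt)).mono_set ball_subset_closedBall

/-- Green's second identity on the unit ball, when one function vanishes on the sphere together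
with its gradient. -/
lemma integral_ball_mul_laplacian {g h : EuclideanSpace ℝ (Fin n) → ℝ}
    (hg : ∀ x ∈ closedBall (0 : EuclideanSpace ℝ (Fin n)) 1, ContDiffAt ℝ 2 g x)
    (hh : ∀ x ∈ closedBall (0 : EuclideanSpace ℝ (Fin n)) 1, ContDiffAt ℝ 2 h x)
    (g0 : ∀ x ∈ sphere (0 : EuclideanSpace ℝ (Fin n)) 1, g x = 0)
    (g1 : ∀ x ∈ sphere (0 : EuclideanSpace ℝ (Fin n)) 1, fderiv ℝ g x = 0) :
    ∫ x in ball (0 : EuclideanSpace ℝ (Fin n)) 1, g x * laplacian h x =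
      ∫ x in ball (0 : EuclideanSpace ℝ (Fin n)) 1, h x * laplacian g x := by
  have h12 : (1 : WithTop ℕ∞) + 1 ≤ 2 := by norm_num
  have hi : ∀ i : Fin n, ∫ x in ball (0 : EuclideanSpace ℝ (Fin n)) 1,
      (g x * pderiv i (pderiv i h) x - h x * pderiv i (pderiv i g) x) = 0 := by
    intro i
    rw [← integral_ball_fderiv_eq_zero (F := fun x => g x * pderiv i h x - h x * pderiv i g x)
      (fun x hx => (((hg x hx).of_le (by norm_num)).mul ((hh x hx).pderiv h12 i)).sub
        (((hh x hx).of_le (by norm_num)).mul ((hg x hx).pderiv h12 i)))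
      (fun x hx => by simp [g0 x hx, pderiv, g1 x hx]) (EuclideanSpace.single i 1)]
    refine setIntegral_congr_fun measurableSet_ball fun x hx => ?_
    have hx := ball_subset_closedBall hx
    have a1 := ((hg x hx).differentiableAt (by norm_num)).hasFDerivAt
    have a2 := ((hh x hx).differentiableAt (by norm_num)).hasFDerivAt
    have a3 := ((hg x hx).differentiableAt_pderiv i).hasFDerivAt
    have a4 := ((hh x hx).differentiableAt_pderiv i).hasFDerivAt
    have := ((a1.mul a4).sub (a2.mul a3)).fderiv
    change _ = fderiv ℝ (g * pderiv i h - h * pderiv i g) x _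
    rw [this]
    simp
    ring
  have h_intg : ∀ {g h : EuclideanSpace ℝ (Fin n) → ℝ},
      (∀ x ∈ closedBall (0 : EuclideanSpace ℝ (Fin n)) 1, ContDiffAt ℝ 2 g x) →
      (∀ x ∈ closedBall (0 : EuclideanSpace ℝ (Fin n)) 1, ContDiffAt ℝ 2 h x) → ∀ i : Fin n,
      IntegrableOn (fun x => g x * pderiv i (pderiv i h) x) (ball 0 1) := by
    intro g h hg hh i
    refine integrableOn_ball_of_continuousAt fun x hx => (hg x hx).continuousAt.mul ?_
    exact (((hh x hx).pderiv h12 i).pderiv (m := 0) (by norm_num) i).continuousAt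
  have e : ∀ {g h : EuclideanSpace ℝ (Fin n) → ℝ},
      (∀ x ∈ closedBall (0 : EuclideanSpace ℝ (Fin n)) 1, ContDiffAt ℝ 2 g x) →
      (∀ x ∈ closedBall (0 : EuclideanSpace ℝ (Fin n)) 1, ContDiffAt ℝ 2 h x) →
      ∫ x in ball (0 : EuclideanSpace ℝ (Fin n)) 1, g x * laplacian h x =
        ∑ i, ∫ x in ball (0 : EuclideanSpace ℝ (Fin n)) 1, g x * pderiv i (pderiv i h) x := by
    intro g h hg hh
    rw [← integral_finsetSum _ fun i _ => h_intg hg hh i]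
    refine setIntegral_congr_fun measurableSet_ball fun x hx => ?_
    simp only [laplacian_eq_sum_pderiv (hh x (ball_subset_closedBall hx)), Finset.mul_sum]
  rw [e hg hh, e hh hg, ← sub_eq_zero, ← Finset.sum_sub_distrib]
  refine Finset.sum_eq_zero fun i _ => ?_
  rw [← integral_sub (h_intg hg hh i) (h_intg hh hg i)]
  exact hi i

end Green

section Kernel

variable {x y : EuclideanSpace ℝ (Fin 4)} {δ : ℝ}

/-- `‖x‖²‖y‖² - 2⟪x, y⟫ + 1`, the squared distance from `x` to the image of `y` under inversion
in the unit sphere, times `‖y‖²`. -/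
noncomputable abbrev kerQ (x : EuclideanSpace ℝ (Fin 4)) : EuclideanSpace ℝ (Fin 4) → ℝ :=
  quad (‖x‖ ^ 2) x 1

/-- `1 - ‖y‖²`. -/
noncomputable abbrev bdry : EuclideanSpace ℝ (Fin 4) → ℝ := quad (-1) 0 1

/-- The regularisation `(1 - δ)‖y - x‖² + δ * kerQ x y` of `‖y - x‖²`. -/
noncomputable abbrev kerP (x : EuclideanSpace ℝ (Fin 4)) (δ : ℝ) :
    EuclideanSpace ℝ (Fin 4) → ℝ :=
  quad (1 - δ * (1 - ‖x‖ ^ 2)) x (‖x‖ ^ 2 + δ * (1 - ‖x‖ ^ 2))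

lemma bdry_eq (y : EuclideanSpace ℝ (Fin 4)) : bdry y = 1 - ‖y‖ ^ 2 := by
  simp [quad]; ring

lemma kerQ_eq : kerQ x y = ‖y - x‖ ^ 2 + (1 - ‖x‖ ^ 2) * (1 - ‖y‖ ^ 2) := by
  rw [norm_sub_sq_real, real_inner_comm]; simp only [quad]; ring

lemma kerP_eq : kerP x δ y = δ * kerQ x y + (1 - δ) * ‖y - x‖ ^ 2 := by
  rw [norm_sub_sq_real, real_inner_comm]; simp only [quad]; ring

lemma kerP_eq_sub : kerP x δ y = kerQ x y - (1 - δ) * (1 - ‖x‖ ^ 2) * bdry y := by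
  rw [kerP_eq, kerQ_eq, bdry_eq]; ring

lemma kerQ_ge (hx : ‖x‖ < 1) (hy : ‖y‖ ≤ 1) : (1 - ‖x‖) ^ 2 ≤ kerQ x y := by
  have h1 := real_inner_le_norm x y
  have h2 : ‖x‖ * ‖y‖ ≤ ‖x‖ := mul_le_of_le_one_right (norm_nonneg x) hy
  simp only [quad]
  nlinarith [norm_nonneg x, norm_nonneg y]

lemma kerQ_pos (hx : ‖x‖ < 1) (hy : ‖y‖ ≤ 1) : 0 < kerQ x y :=
  lt_of_lt_of_le (by have := sub_pos.2 hx; positivity) (kerQ_ge hx hy)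

lemma kerP_pos (hx : ‖x‖ < 1) (hy : ‖y‖ ≤ 1) (h0 : 0 < δ) (h1 : δ < 1) : 0 < kerP x δ y := by
  rw [kerP_eq]
  have := kerQ_pos hx hy
  have := sub_pos.2 h1
  positivity

lemma pderiv_inv_pow_quad {α γ : ℝ} {β : EuclideanSpace ℝ (Fin 4)} (k : ℕ) (i : Fin 4)
    (hy : quad α β γ y ≠ 0) :
    pderiv i (fun y => (quad α β γ y ^ k)⁻¹) y =
      -k * (quad α β γ y ^ (k + 1))⁻¹ * pderiv i (quad α β γ) y := by
  have hd : HasDerivAt (fun z : ℝ => (z ^ k)⁻¹) (-k * (quad α β γ y ^ (k + 1))⁻¹)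
      (quad α β γ y) := hasDerivAt_inv_pow k hy
  have hq : DifferentiableAt ℝ (quad α β γ) y :=
    (contDiff_quad (k := 1)).contDiffAt.differentiableAt (by norm_num)
  have := (hd.comp_hasFDerivAt y hq.hasFDerivAt).fderiv
  rw [pderiv]
  change fderiv ℝ ((fun z : ℝ => (z ^ k)⁻¹) ∘ quad α β γ) y _ = _
  rw [this]
  simp

lemma contDiffAt_inv_pow_quad {α γ : ℝ} {β : EuclideanSpace ℝ (Fin 4)} (k : ℕ)
    {m : WithTop ℕ∞} (hy : quad α β γ y ≠ 0) :
    ContDiffAt ℝ m (fun y => (quad α β γ y ^ k)⁻¹) y :=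
  (contDiff_quad.contDiffAt.pow k).inv (pow_ne_zero k hy)

lemma laplacian_bdry_mul_inv_pow (k : ℕ) (hy : kerQ x y ≠ 0) :
    laplacian (fun y => bdry y * (kerQ x y ^ k)⁻¹) y =
      (4 * k - 8) * (kerQ x y ^ k)⁻¹ +
        4 * k * (k - 2) * ‖x‖ ^ 2 * (bdry y * (kerQ x y ^ (k + 1))⁻¹) -
        4 * k * (1 - ‖x‖ ^ 2) * (kerQ x y ^ (k + 1))⁻¹ := by
  rw [laplacian_mul contDiff_quad.contDiffAt (contDiffAt_inv_pow_quad k hy),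
    laplacian_inv_pow_quad k hy, laplacian_quad]
  simp only [pderiv_inv_pow_quad k _ hy]
  have h : ∀ i, pderiv i bdry y * (-(k : ℝ) * (kerQ x y ^ (k + 1))⁻¹ * pderiv i (kerQ x) y) =
      -(k : ℝ) * (kerQ x y ^ (k + 1))⁻¹ * (pderiv i bdry y * pderiv i (kerQ x) y) := by
    intro i; ring
  simp only [h, ← Finset.mul_sum]
  rw [sum_pderiv_quad_mul]
  have e : inner ℝ x y = (‖x‖ ^ 2 * ‖y‖ ^ 2 + 1 - kerQ x y) / 2 := by
    simp only [quad]; ring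
  have e' : ‖y‖ ^ 2 = 1 - bdry y := by rw [bdry_eq]; ring
  rw [e, e']
  simp only [inner_zero_left]
  field_simp
  ring

/-- Regularisation of the Green function of the Dirichlet bi-Laplacian. -/
noncomputable def greenReg (x : EuclideanSpace ℝ (Fin 4)) (δ : ℝ)
    (y : EuclideanSpace ℝ (Fin 4)) : ℝ :=
  log (kerQ x y) - log (kerP x δ y) -
    (1 - δ) * (1 - ‖x‖ ^ 2) * (bdry y * (kerQ x y ^ 1)⁻¹)

lemma contDiffAt_greenReg {m : WithTop ℕ∞} (hQ : kerQ x y ≠ 0) (hP : kerP x δ y ≠ 0) :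
    ContDiffAt ℝ m (greenReg x δ) y := by
  unfold greenReg
  exact ((contDiff_quad.contDiffAt.log hQ).sub (contDiff_quad.contDiffAt.log hP)).sub
    (contDiffAt_const.mul (contDiff_quad.contDiffAt.mul (contDiffAt_inv_pow_quad 1 hQ)))

lemma laplacian_greenReg (hQ : kerQ x y ≠ 0) (hP : kerP x δ y ≠ 0) :
    laplacian (greenReg x δ) y =
      4 * (1 - (1 - ‖x‖ ^ 2) * δ) * (kerQ x y ^ 1)⁻¹ -
        4 * (1 - δ * (1 - ‖x‖ ^ 2)) * (kerP x δ y ^ 1)⁻¹ -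
        4 * (δ * (1 - δ) * (1 - ‖x‖ ^ 2) ^ 2) * (kerP x δ y ^ 2)⁻¹ +
        4 * (1 - δ) * (1 - ‖x‖ ^ 2) ^ 2 * (kerQ x y ^ 2)⁻¹ +
        4 * (1 - δ) * (1 - ‖x‖ ^ 2) * ‖x‖ ^ 2 * (bdry y * (kerQ x y ^ 2)⁻¹) := by
  unfold greenReg
  rw [laplacian_sub ((contDiff_quad.contDiffAt.log hQ).sub (contDiff_quad.contDiffAt.log hP))
    (contDiffAt_const.mul (contDiff_quad.contDiffAt.mul (contDiffAt_inv_pow_quad 1 hQ))),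
    laplacian_sub (contDiff_quad.contDiffAt.log hQ) (contDiff_quad.contDiffAt.log hP),
    laplacian_const_mul _ (contDiff_quad.contDiffAt.mul (contDiffAt_inv_pow_quad 1 hQ)),
    laplacian_log_quad hQ, laplacian_log_quad hP, laplacian_bdry_mul_inv_pow 1 hQ]
  push_cast
  simp only [pow_one]
  ring

lemma laplacian_laplacian_greenReg (hQ : kerQ x y ≠ 0) (hP : kerP x δ y ≠ 0) :
    laplacian (laplacian (greenReg x δ)) y =
      96 * (δ * (1 - δ) * (1 - ‖x‖ ^ 2) ^ 2) ^ 2 * (kerP x δ y ^ 4)⁻¹ := by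
  have hev : laplacian (greenReg x δ) =ᶠ[𝓝 y] fun y =>
      4 * (1 - (1 - ‖x‖ ^ 2) * δ) * (kerQ x y ^ 1)⁻¹ -
        4 * (1 - δ * (1 - ‖x‖ ^ 2)) * (kerP x δ y ^ 1)⁻¹ -
        4 * (δ * (1 - δ) * (1 - ‖x‖ ^ 2) ^ 2) * (kerP x δ y ^ 2)⁻¹ +
        4 * (1 - δ) * (1 - ‖x‖ ^ 2) ^ 2 * (kerQ x y ^ 2)⁻¹ +
        4 * (1 - δ) * (1 - ‖x‖ ^ 2) * ‖x‖ ^ 2 * (bdry y * (kerQ x y ^ 2)⁻¹) := by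
    filter_upwards [(contDiff_quad (k := 0)).continuous.continuousAt.eventually_ne hQ,
      (contDiff_quad (k := 0)).continuous.continuousAt.eventually_ne hP] with z h1 h2
    exact laplacian_greenReg h1 h2
  have c1 := fun k => contDiffAt_inv_pow_quad k (m := 2) hQ
  have c2 := fun k => contDiffAt_inv_pow_quad k (m := 2) hP
  have c3 : ∀ k, ContDiffAt ℝ 2 (fun y => bdry y * (kerQ x y ^ k)⁻¹) y := fun k =>
    contDiff_quad.contDiffAt.mul (c1 k)
  have m : ∀ {f : EuclideanSpace ℝ (Fin 4) → ℝ} (c : ℝ), ContDiffAt ℝ 2 f y →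
      ContDiffAt ℝ 2 (fun y => c * f y) y := fun c h => contDiffAt_const.mul h
  rw [laplacian_congr hev,
    laplacian_add ((((m _ (c1 1)).sub (m _ (c2 1))).sub (m _ (c2 2))).add (m _ (c1 2)))
      (m _ (c3 2)),
    laplacian_add (((m _ (c1 1)).sub (m _ (c2 1))).sub (m _ (c2 2))) (m _ (c1 2)),
    laplacian_sub ((m _ (c1 1)).sub (m _ (c2 1))) (m _ (c2 2)),
    laplacian_sub (m _ (c1 1)) (m _ (c2 1)),
    laplacian_const_mul _ (c1 1), laplacian_const_mul _ (c2 1), laplacian_const_mul _ (c2 2),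
    laplacian_const_mul _ (c1 2), laplacian_const_mul _ (c3 2), laplacian_inv_pow_quad _ hQ,
    laplacian_inv_pow_quad _ hP, laplacian_inv_pow_quad _ hP, laplacian_inv_pow_quad _ hQ,
    laplacian_bdry_mul_inv_pow 2 hQ]
  push_cast
  ring

lemma greenReg_eq_zero (hy : ‖y‖ = 1) : greenReg x δ y = 0 := by
  have hb : bdry y = 0 := by rw [bdry_eq, hy]; norm_num
  rw [greenReg, kerP_eq_sub, hb]; simp

lemma fderiv_greenReg_eq_zero (hQ : kerQ x y ≠ 0) (hy : ‖y‖ = 1) :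
    fderiv ℝ (greenReg x δ) y = 0 := by
  have hb : bdry y = 0 := by rw [bdry_eq, hy]; norm_num
  have hP : kerP x δ y = kerQ x y := by rw [kerP_eq_sub, hb]; ring
  have dQ : HasFDerivAt (kerQ x) (fderiv ℝ (kerQ x) y) y :=
    ((contDiff_quad (k := 1)).contDiffAt.differentiableAt (by norm_num)).hasFDerivAt
  have db : HasFDerivAt bdry (fderiv ℝ bdry y) y :=
    ((contDiff_quad (k := 1)).contDiffAt.differentiableAt (by norm_num)).hasFDerivAt
  have dP : HasFDerivAt (kerP x δ)
      (fderiv ℝ (kerQ x) y - ((1 - δ) * (1 - ‖x‖ ^ 2)) • fderiv ℝ bdry y) y := by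
    have : kerP x δ = fun y => kerQ x y - (1 - δ) * (1 - ‖x‖ ^ 2) * bdry y := by
      funext y; exact kerP_eq_sub
    rw [this]
    exact dQ.sub (db.const_mul _)
  have dI : HasFDerivAt (fun y => (kerQ x y ^ 1)⁻¹) (-(kerQ x y ^ 2)⁻¹ • fderiv ℝ (kerQ x) y) y := by
    simp only [pow_one]
    exact (hasDerivAt_inv hQ).comp_hasFDerivAt y dQ
  have h := ((dQ.log hQ).sub (dP.log (by rw [hP]; exact hQ))).sub
    ((db.mul dI).const_mul ((1 - δ) * (1 - ‖x‖ ^ 2)))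
  refine HasFDerivAt.fderiv ?_
  refine h.congr_fderiv ?_
  ext v
  simp [hP, hb]
  ring

lemma integral_greenReg {w : EuclideanSpace ℝ (Fin 4) → ℝ} (hw : ContDiff ℝ 4 w)
    (w0 : ∀ x ∈ sphere (0 : EuclideanSpace ℝ (Fin 4)) 1, w x = 0)
    (w1 : ∀ x ∈ sphere (0 : EuclideanSpace ℝ (Fin 4)) 1, fderiv ℝ w x = 0)
    (hx : ‖x‖ < 1) (h0 : 0 < δ) (h1 : δ < 1) :
    ∫ y in ball (0 : EuclideanSpace ℝ (Fin 4)) 1, greenReg x δ y * laplacian (laplacian w) y =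
      ∫ y in ball (0 : EuclideanSpace ℝ (Fin 4)) 1, w y *
        (96 * (δ * (1 - δ) * (1 - ‖x‖ ^ 2) ^ 2) ^ 2 * (kerP x δ y ^ 4)⁻¹) := by
  have hQ : ∀ y ∈ closedBall (0 : EuclideanSpace ℝ (Fin 4)) 1, kerQ x y ≠ 0 := fun y hy =>
    (kerQ_pos hx (by simpa using hy)).ne'
  have hP : ∀ y ∈ closedBall (0 : EuclideanSpace ℝ (Fin 4)) 1, kerP x δ y ≠ 0 := fun y hy =>
    (kerP_pos hx (by simpa using hy) h0 h1).ne'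
  have hG : ∀ y ∈ closedBall (0 : EuclideanSpace ℝ (Fin 4)) 1,
      ContDiffAt ℝ 4 (greenReg x δ) y := fun y hy => contDiffAt_greenReg (hQ y hy) (hP y hy)
  rw [integral_ball_mul_laplacian (fun y hy => (hG y hy).of_le (by norm_num))
    (fun y _ => hw.contDiffAt.laplacian (by norm_num))
    (fun y hy => greenReg_eq_zero (by simpa using hy))
    (fun y hy => fderiv_greenReg_eq_zero (hQ y (sphere_subset_closedBall hy)) (by simpa using hy))]
  simp only [mul_comm (laplacian w _)]
  rw [← integral_ball_mul_laplacian (g := w) (fun y _ => hw.contDiffAt.of_le (by norm_num))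
    (fun y hy => (hG y hy).laplacian (by norm_num)) w0 w1]
  refine setIntegral_congr_fun measurableSet_ball fun y hy => ?_
  have hy := ball_subset_closedBall hy
  simp only [laplacian_laplacian_greenReg (hQ y hy) (hP y hy)]

end Kernel

section GreenFunction

variable {x y : EuclideanSpace ℝ (Fin 4)} {δ : ℝ}

/-- The Green function of the Dirichlet bi-Laplacian on the unit ball of `ℝ⁴`, up to a
multiplicative constant. -/
noncomputable def green (x y : EuclideanSpace ℝ (Fin 4)) : ℝ :=
  log (kerQ x y) - log (‖y - x‖ ^ 2) - (1 - ‖x‖ ^ 2) * (1 - ‖y‖ ^ 2) * (kerQ x y)⁻¹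

/-- The normalising constant of `green`. -/
noncomputable def greenConst : ℝ :=
  ∫ z : EuclideanSpace ℝ (Fin 4), 96 * ((1 + ‖z‖ ^ 2) ^ 4)⁻¹

lemma integrable_inv_one_add_norm_sq_pow :
    Integrable (fun z : EuclideanSpace ℝ (Fin 4) => ((1 + ‖z‖ ^ 2) ^ 4)⁻¹) := by
  have h := integrable_rpow_neg_one_add_norm_sq (E := EuclideanSpace ℝ (Fin 4)) (μ := volume)
    (r := 8) (by simp; norm_num)
  refine h.congr (Filter.Eventually.of_forall fun z => ?_)
  have : (0 : ℝ) ≤ 1 + ‖z‖ ^ 2 := by positivity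
  have e : (-8 / 2 : ℝ) = -((4 : ℕ) : ℝ) := by norm_num
  simp only [e, rpow_neg this, rpow_natCast]

lemma greenConst_pos : 0 < greenConst := by
  unfold greenConst
  refine (integral_pos_iff_support_of_nonneg (fun z => by positivity)
    (integrable_inv_one_add_norm_sq_pow.const_mul 96)).2 ?_
  have : Function.support (fun z : EuclideanSpace ℝ (Fin 4) => 96 * ((1 + ‖z‖ ^ 2) ^ 4)⁻¹) =
      Set.univ := by
    refine Set.eq_univ_of_forall fun z => ?_
    rw [Function.mem_support]
    positivity
  rw [this]
  simp

lemma integrableOn_inv_norm_sub (x : EuclideanSpace ℝ (Fin 4)) :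
    IntegrableOn (fun y : EuclideanSpace ℝ (Fin 4) => ‖y - x‖⁻¹) (ball 0 1) := by
  have h : IntegrableOn (fun y : EuclideanSpace ℝ (Fin 4) => ‖y‖⁻¹) (ball 0 (‖x‖ + 1)) := by
    refine (integrableOn_fun_norm_addHaar (μ := volume) (f := fun t => t⁻¹)).2 ?_
    have : IntegrableOn (fun y : ℝ => y ^ 2) (Set.Ioo 0 (‖x‖ + 1)) :=
      ((continuous_pow 2).integrableOn_Icc (a := 0) (b := ‖x‖ + 1)).mono_set Set.Ioo_subset_Icc_self
    refine this.congr_fun (fun t ht => ?_) measurableSet_Ioo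
    have := ht.1
    simp
    field_simp
  have h2 : IntegrableOn (fun y : EuclideanSpace ℝ (Fin 4) => ‖y - x‖⁻¹)
      ((fun y => y - x) ⁻¹' ball 0 (‖x‖ + 1)) :=
    ((measurePreserving_sub_right volume x).integrableOn_comp_preimage
      (Homeomorph.subRight x).measurableEmbedding).2 h
  refine h2.mono_set fun y hy => ?_
  simp only [Set.mem_preimage, mem_ball_zero_iff] at hy ⊢
  linarith [norm_sub_le y x]

lemma kerQ_le (hx : ‖x‖ ≤ 1) (hy : ‖y‖ ≤ 1) : kerQ x y ≤ 4 := by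
  have h1 := abs_le.1 (abs_real_inner_le_norm x y)
  have h2 : ‖x‖ * ‖y‖ ≤ 1 := mul_le_one₀ hx (norm_nonneg y) hy
  have h3 : 0 ≤ ‖x‖ * ‖y‖ := by positivity
  simp only [quad]
  nlinarith

lemma greenReg_nonneg (hx : ‖x‖ < 1) (hy : ‖y‖ ≤ 1) (h0 : 0 < δ) (h1 : δ < 1) :
    0 ≤ greenReg x δ y := by
  have hQ := kerQ_pos hx hy
  have hP := kerP_pos hx hy h0 h1
  have h := log_le_sub_one_of_pos (div_pos hP hQ)
  rw [log_div hP.ne' hQ.ne', kerP_eq_sub] at h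
  have e : (kerQ x y - (1 - δ) * (1 - ‖x‖ ^ 2) * bdry y) / kerQ x y - 1 =
      -((1 - δ) * (1 - ‖x‖ ^ 2) * (bdry y * (kerQ x y ^ 1)⁻¹)) := by
    field_simp
    ring
  rw [e, ← kerP_eq_sub] at h
  rw [greenReg]
  linarith

lemma greenReg_le (hx : ‖x‖ < 1) (hy : ‖y‖ ≤ 1) (hxy : y ≠ x) (h0 : 0 < δ) (h1 : δ ≤ 1 / 2) :
    greenReg x δ y ≤ 7 + 2 * ‖y - x‖⁻¹ := by
  have hQ := kerQ_pos hx hy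
  have hr : 0 < ‖y - x‖ := norm_pos_iff.2 (sub_ne_zero.2 hxy)
  have hP : ‖y - x‖ ^ 2 / 2 ≤ kerP x δ y := by
    rw [kerP_eq]; nlinarith [mul_pos h0 hQ, sq_nonneg ‖y - x‖]
  have l1 : log (kerQ x y) ≤ 3 := by
    have := log_le_sub_one_of_pos hQ
    linarith [kerQ_le hx.le hy]
  have l2 : log (‖y - x‖ ^ 2 / 2) ≤ log (kerP x δ y) := log_le_log (by positivity) hP
  rw [log_div (by positivity) two_ne_zero, log_pow] at l2
  have l3 : log 2 ≤ 1 := by linarith [log_le_sub_one_of_pos (two_pos : (0 : ℝ) < 2)]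
  have l4 := log_le_sub_one_of_pos (inv_pos.2 hr)
  rw [log_inv] at l4
  have hb : 0 ≤ (1 - δ) * (1 - ‖x‖ ^ 2) * (bdry y * (kerQ x y ^ 1)⁻¹) := by
    rw [bdry_eq, pow_one]
    have a1 : 0 ≤ 1 - δ := by linarith
    have a2 : 0 ≤ 1 - ‖x‖ ^ 2 := by nlinarith [norm_nonneg x]
    have a3 : 0 ≤ 1 - ‖y‖ ^ 2 := by nlinarith [norm_nonneg y]
    positivity
  rw [greenReg]
  push_cast at l2
  linarith

lemma tendsto_greenReg (hxy : y ≠ x) :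
    Filter.Tendsto (fun ε : ℝ => greenReg x (ε ^ 2) y) (𝓝[>] 0) (𝓝 (green x y)) := by
  have hr : ‖y - x‖ ^ 2 ≠ 0 := pow_ne_zero 2 (norm_ne_zero_iff.2 (sub_ne_zero.2 hxy))
  have hc : ContinuousAt (fun ε : ℝ => log (kerQ x y) -
      log (ε ^ 2 * kerQ x y + (1 - ε ^ 2) * ‖y - x‖ ^ 2) -
      (1 - ε ^ 2) * (1 - ‖x‖ ^ 2) * (bdry y * (kerQ x y ^ 1)⁻¹)) 0 := by
    refine (continuousAt_const.sub (ContinuousAt.log (by fun_prop) ?_)).sub (by fun_prop)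
    simpa using hr
  have h := hc.tendsto.mono_left (nhdsWithin_le_nhds (s := Set.Ioi 0))
  have e : log (kerQ x y) - log ((0 : ℝ) ^ 2 * kerQ x y + (1 - (0 : ℝ) ^ 2) * ‖y - x‖ ^ 2) -
      (1 - (0 : ℝ) ^ 2) * (1 - ‖x‖ ^ 2) * (bdry y * (kerQ x y ^ 1)⁻¹) = green x y := by
    rw [green, bdry_eq]
    norm_num
    ring
  rw [e] at h
  refine h.congr fun ε => ?_
  rw [greenReg, kerP_eq]

lemma measurable_green (x : EuclideanSpace ℝ (Fin 4)) : Measurable (green x) := by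
  unfold green
  have := (contDiff_quad (α := ‖x‖ ^ 2) (β := x) (γ := 1) (k := 0)).continuous.measurable
  fun_prop

lemma eventually_small : ∀ᶠ ε : ℝ in 𝓝[>] 0, 0 < ε ^ 2 ∧ ε ^ 2 ≤ 1 / 2 := by
  filter_upwards [Ioo_mem_nhdsGT (show (0 : ℝ) < 1 / 2 by norm_num)] with ε hε
  constructor <;> nlinarith [hε.1, hε.2]

lemma ae_ball_ne (x : EuclideanSpace ℝ (Fin 4)) :
    ∀ᵐ y ∂(volume.restrict (ball (0 : EuclideanSpace ℝ (Fin 4)) 1)),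
      ‖y‖ ≤ 1 ∧ y ≠ x := by
  filter_upwards [ae_restrict_mem measurableSet_ball,
    ae_restrict_of_ae (measure_eq_zero_iff_ae_notMem.1 (measure_singleton (μ := volume) x))]
    with y h1 h2
  exact ⟨(mem_ball_zero_iff.1 h1).le, h2⟩

lemma green_mem_Icc (hx : ‖x‖ < 1) (hy : ‖y‖ ≤ 1) (hxy : y ≠ x) :
    0 ≤ green x y ∧ green x y ≤ 7 + 2 * ‖y - x‖⁻¹ := by
  have h := tendsto_greenReg hxy
  constructor
  · refine ge_of_tendsto h ?_
    filter_upwards [eventually_small] with ε hε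
    exact greenReg_nonneg hx hy hε.1 (by linarith [hε.2])
  · refine le_of_tendsto h ?_
    filter_upwards [eventually_small] with ε hε
    exact greenReg_le hx hy hxy hε.1 hε.2

lemma integrableOn_green_bound (x : EuclideanSpace ℝ (Fin 4)) :
    IntegrableOn (fun y : EuclideanSpace ℝ (Fin 4) => 7 + 2 * ‖y - x‖⁻¹) (ball 0 1) :=
  (integrableOn_const measure_ball_lt_top.ne).add ((integrableOn_inv_norm_sub x).const_mul 2)

lemma integrableOn_green_mul {f : EuclideanSpace ℝ (Fin 4) → ℝ} (hx : ‖x‖ < 1)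
    (hf : Continuous f) : IntegrableOn (fun y => green x y * f y) (ball 0 1) := by
  have hg : IntegrableOn (green x) (ball 0 1) := by
    refine (integrableOn_green_bound x).mono' (measurable_green x).aestronglyMeasurable ?_
    filter_upwards [ae_ball_ne x] with y hy
    obtain ⟨h1, h2⟩ := green_mem_Icc hx hy.1 hy.2
    rwa [Real.norm_eq_abs, abs_of_nonneg h1]
  obtain ⟨C, hC⟩ := (isCompact_closedBall (0 : EuclideanSpace ℝ (Fin 4))
    1).exists_bound_of_continuousOn hf.continuousOn
  refine hg.mul_bdd (c := C) hf.aestronglyMeasurable ?_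
  filter_upwards [ae_ball_ne x] with y hy
  exact hC y (by simpa using hy.1)

lemma tendsto_integral_greenReg {f : EuclideanSpace ℝ (Fin 4) → ℝ} (hx : ‖x‖ < 1)
    (hf : Continuous f) :
    Filter.Tendsto (fun ε : ℝ => ∫ y in ball (0 : EuclideanSpace ℝ (Fin 4)) 1,
      greenReg x (ε ^ 2) y * f y) (𝓝[>] 0)
      (𝓝 (∫ y in ball (0 : EuclideanSpace ℝ (Fin 4)) 1, green x y * f y)) := by
  obtain ⟨C, hC⟩ := (isCompact_closedBall (0 : EuclideanSpace ℝ (Fin 4))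
    1).exists_bound_of_continuousOn hf.continuousOn
  refine tendsto_integral_filter_of_dominated_convergence
    (fun y => (7 + 2 * ‖y - x‖⁻¹) * C) ?_ ?_ ((integrableOn_green_bound x).mul_const C) ?_
  · filter_upwards with ε
    have m1 := (contDiff_quad (α := ‖x‖ ^ 2) (β := x) (γ := 1) (k := 0)).continuous.measurable
    have m2 := (contDiff_quad (α := 1 - ε ^ 2 * (1 - ‖x‖ ^ 2)) (β := x)
      (γ := ‖x‖ ^ 2 + ε ^ 2 * (1 - ‖x‖ ^ 2)) (k := 0)).continuous.measurable
    have m3 := (contDiff_quad (α := -1) (β := 0) (γ := 1) (k := 0)).continuous.measurable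
    have : Measurable (greenReg x (ε ^ 2)) := by unfold greenReg; fun_prop
    exact (this.mul hf.measurable).aestronglyMeasurable
  · filter_upwards [eventually_small] with ε hε
    filter_upwards [ae_ball_ne x] with y hy
    have h1 := greenReg_nonneg hx hy.1 hε.1 (by linarith [hε.2])
    have h2 := greenReg_le hx hy.1 hy.2 hε.1 hε.2
    rw [norm_mul, Real.norm_eq_abs, abs_of_nonneg h1]
    exact mul_le_mul h2 (hC y (by simpa using hy.1)) (norm_nonneg _) (h1.trans h2)
  · filter_upwards [ae_ball_ne x] with y hy
    exact (tendsto_greenReg hy.2).mul_const _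

lemma integral_bubble_rescale (hx : ‖x‖ < 1) (w : EuclideanSpace ℝ (Fin 4) → ℝ) {ε : ℝ}
    (hε : 0 < ε) :
    ∫ y in ball (0 : EuclideanSpace ℝ (Fin 4)) 1, w y *
        (96 * (ε ^ 2 * (1 - ε ^ 2) * (1 - ‖x‖ ^ 2) ^ 2) ^ 2 * (kerP x (ε ^ 2) y ^ 4)⁻¹) =
      ∫ z, (ball (0 : EuclideanSpace ℝ (Fin 4)) 1).indicator w (x + ((1 - ‖x‖ ^ 2) * ε) • z) *
        (96 * (1 - ε ^ 2) ^ 2 * (1 - ‖x‖ ^ 2) ^ 8 *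
          ((kerQ x (x + ((1 - ‖x‖ ^ 2) * ε) • z) +
            (1 - ε ^ 2) * (1 - ‖x‖ ^ 2) ^ 2 * ‖z‖ ^ 2) ^ 4)⁻¹) := by
  set A := 1 - ‖x‖ ^ 2 with hA
  have hA0 : 0 < A := by rw [hA]; nlinarith [norm_nonneg x]
  rw [← integral_indicator measurableSet_ball]
  set F : EuclideanSpace ℝ (Fin 4) → ℝ := (ball (0 : EuclideanSpace ℝ (Fin 4)) 1).indicator
    fun y => w y * (96 * (ε ^ 2 * (1 - ε ^ 2) * A ^ 2) ^ 2 * (kerP x (ε ^ 2) y ^ 4)⁻¹) with hF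
  have h1 : ∫ z, F (x + (A * ε) • z) = ((A * ε) ^ 4)⁻¹ * ∫ y, F y := by
    have := Measure.integral_comp_smul (μ := volume) (fun z => F (x + z)) (A * ε)
    rw [this, integral_add_left_eq_self F x]
    rw [finrank_euclideanSpace_fin, abs_of_nonneg (by positivity), smul_eq_mul]
  have h2 : ∫ y, F y = ∫ z, (A * ε) ^ 4 * F (x + (A * ε) • z) := by
    rw [integral_const_mul, h1, ← mul_assoc, mul_inv_cancel₀ (by positivity), one_mul]
  rw [h2]
  refine integral_congr_ae (Filter.Eventually.of_forall fun z => ?_)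
  simp only [hF]
  by_cases hz : x + (A * ε) • z ∈ ball (0 : EuclideanSpace ℝ (Fin 4)) 1
  · rw [Set.indicator_of_mem hz, Set.indicator_of_mem hz]
    have e : kerP x (ε ^ 2) (x + (A * ε) • z) =
        ε ^ 2 * (kerQ x (x + (A * ε) • z) + (1 - ε ^ 2) * A ^ 2 * ‖z‖ ^ 2) := by
      rw [kerP_eq, add_sub_cancel_left, norm_smul, Real.norm_eq_abs, mul_pow, sq_abs]
      ring
    rw [e]
    field_simp
  · rw [Set.indicator_of_notMem hz, Set.indicator_of_notMem hz]
    simp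

lemma tendsto_integral_bubble (hx : ‖x‖ < 1) {w : EuclideanSpace ℝ (Fin 4) → ℝ}
    (hw : Continuous w) :
    Filter.Tendsto (fun ε : ℝ => ∫ y in ball (0 : EuclideanSpace ℝ (Fin 4)) 1, w y *
        (96 * (ε ^ 2 * (1 - ε ^ 2) * (1 - ‖x‖ ^ 2) ^ 2) ^ 2 * (kerP x (ε ^ 2) y ^ 4)⁻¹))
      (𝓝[>] 0) (𝓝 (greenConst * w x)) := by
  have hcongr : (fun ε : ℝ => ∫ z, (ball (0 : EuclideanSpace ℝ (Fin 4)) 1).indicator w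
      (x + ((1 - ‖x‖ ^ 2) * ε) • z) * (96 * (1 - ε ^ 2) ^ 2 * (1 - ‖x‖ ^ 2) ^ 8 *
          ((kerQ x (x + ((1 - ‖x‖ ^ 2) * ε) • z) +
            (1 - ε ^ 2) * (1 - ‖x‖ ^ 2) ^ 2 * ‖z‖ ^ 2) ^ 4)⁻¹)) =ᶠ[𝓝[>] 0]
      fun ε : ℝ => ∫ y in ball (0 : EuclideanSpace ℝ (Fin 4)) 1, w y *
        (96 * (ε ^ 2 * (1 - ε ^ 2) * (1 - ‖x‖ ^ 2) ^ 2) ^ 2 * (kerP x (ε ^ 2) y ^ 4)⁻¹) := by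
    filter_upwards [self_mem_nhdsWithin] with ε hε
    exact (integral_bubble_rescale hx w hε).symm
  refine Filter.Tendsto.congr' hcongr ?_
  have hA0 : 0 < 1 - ‖x‖ ^ 2 := by nlinarith [norm_nonneg x]
  have hAm : (1 - ‖x‖ ^ 2) ^ 2 ≤ 4 * (1 - ‖x‖) ^ 2 := by
    have : (1 - ‖x‖ ^ 2) ^ 2 = (1 + ‖x‖) ^ 2 * (1 - ‖x‖) ^ 2 := by ring
    rw [this]
    refine mul_le_mul_of_nonneg_right ?_ (sq_nonneg _)
    nlinarith [norm_nonneg x]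
  have hQx : kerQ x x = (1 - ‖x‖ ^ 2) ^ 2 := by rw [kerQ_eq]; simp; ring
  generalize 1 - ‖x‖ ^ 2 = A at hA0 hAm hQx ⊢
  obtain ⟨C, hC⟩ := (isCompact_closedBall (0 : EuclideanSpace ℝ (Fin 4))
    1).exists_bound_of_continuousOn hw.continuousOn
  have hC0 : 0 ≤ C := (norm_nonneg _).trans (hC 0 (by simp))
  have hlim : greenConst * w x =
      ∫ z : EuclideanSpace ℝ (Fin 4), w x * (96 * ((1 + ‖z‖ ^ 2) ^ 4)⁻¹) := by
    rw [integral_const_mul, greenConst, mul_comm]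
  rw [hlim]
  have hQc : Continuous (kerQ x) := (contDiff_quad (k := 0)).continuous
  refine tendsto_integral_filter_of_dominated_convergence
    (fun z => C * (96 * 4 ^ 4 * ((1 + ‖z‖ ^ 2) ^ 4)⁻¹)) ?_ ?_
    ((integrable_inv_one_add_norm_sq_pow.const_mul _).const_mul C) ?_
  · filter_upwards with ε
    have m1 : Measurable ((ball (0 : EuclideanSpace ℝ (Fin 4)) 1).indicator w) :=
      hw.measurable.indicator measurableSet_ball
    have m2 := hQc.measurable
    have m3 : Measurable fun z : EuclideanSpace ℝ (Fin 4) => x + (A * ε) • z := by fun_prop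
    exact ((m1.comp m3).mul (measurable_const.mul ((((m2.comp m3).add (by fun_prop)).pow_const
      4).inv))).aestronglyMeasurable
  · filter_upwards [eventually_small] with ε hε
    filter_upwards with z
    by_cases hz : x + (A * ε) • z ∈ ball (0 : EuclideanSpace ℝ (Fin 4)) 1
    · rw [Set.indicator_of_mem hz, norm_mul]
      refine mul_le_mul (hC _ (ball_subset_closedBall hz)) ?_ (norm_nonneg _) hC0
      have hQ := kerQ_ge hx (mem_ball_zero_iff.1 hz).le
      have hden : A ^ 2 * ((1 + ‖z‖ ^ 2) / 4) ≤ kerQ x (x + (A * ε) • z) +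
          (1 - ε ^ 2) * A ^ 2 * ‖z‖ ^ 2 := by
        have : 0 ≤ A ^ 2 * ‖z‖ ^ 2 := by positivity
        nlinarith [hε.2]
      have hpos : 0 < A ^ 2 * ((1 + ‖z‖ ^ 2) / 4) := by positivity
      have h1 : 0 ≤ 1 - ε ^ 2 := by linarith [hε.2]
      have h2 : (1 - ε ^ 2) ^ 2 ≤ 1 := by nlinarith [hε.1]
      have hpos' := hpos.trans_le hden
      rw [Real.norm_eq_abs, abs_of_nonneg (by positivity)]
      calc _ ≤ 96 * 1 * A ^ 8 * ((A ^ 2 * ((1 + ‖z‖ ^ 2) / 4)) ^ 4)⁻¹ := by gcongr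
        _ = _ := by field_simp
    · rw [Set.indicator_of_notMem hz, zero_mul, norm_zero]
      positivity
  · filter_upwards with z
    have hline : Filter.Tendsto (fun ε : ℝ => x + (A * ε) • z) (𝓝[>] 0) (𝓝 x) := by
      have : ContinuousAt (fun ε : ℝ => x + (A * ε) • z) 0 := by fun_prop
      have h := this.tendsto.mono_left (nhdsWithin_le_nhds (s := Set.Ioi 0))
      simpa using h
    have hxb : x ∈ ball (0 : EuclideanSpace ℝ (Fin 4)) 1 := by simpa using hx
    have t1 : Filter.Tendsto (fun ε : ℝ => (ball (0 : EuclideanSpace ℝ (Fin 4)) 1).indicator w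
        (x + (A * ε) • z)) (𝓝[>] 0) (𝓝 (w x)) := by
      refine (hw.continuousAt.tendsto.comp hline).congr' ?_
      filter_upwards [hline.eventually (isOpen_ball.mem_nhds hxb)] with ε hε
      have hε' : x + (A * ε) • z ∈ ball (0 : EuclideanSpace ℝ (Fin 4)) 1 := hε
      rw [Set.indicator_of_mem hε']; rfl
    have t2 : Filter.Tendsto (fun ε : ℝ => kerQ x (x + (A * ε) • z)) (𝓝[>] 0) (𝓝 (A ^ 2)) := by
      rw [← hQx]; exact hQc.continuousAt.tendsto.comp hline
    have t3 : Filter.Tendsto (fun ε : ℝ => 1 - ε ^ 2) (𝓝[>] 0) (𝓝 1) := by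
      have : ContinuousAt (fun ε : ℝ => 1 - ε ^ 2) 0 := by fun_prop
      have h := this.tendsto.mono_left (nhdsWithin_le_nhds (s := Set.Ioi 0))
      simpa using h
    have t4 := ((t2.add ((t3.mul_const (A ^ 2)).mul_const (‖z‖ ^ 2))).pow 4).inv₀ (by positivity)
    have t5 := t1.mul ((((t3.pow 2).const_mul 96).mul_const (A ^ 8)).mul t4)
    convert t5 using 2
    field_simp

/-- Green representation of functions with vanishing Dirichlet data. -/
theorem green_representation {w : EuclideanSpace ℝ (Fin 4) → ℝ} (hw : ContDiff ℝ 4 w)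
    (w0 : ∀ x ∈ sphere (0 : EuclideanSpace ℝ (Fin 4)) 1, w x = 0)
    (w1 : ∀ x ∈ sphere (0 : EuclideanSpace ℝ (Fin 4)) 1, fderiv ℝ w x = 0) (hx : ‖x‖ < 1) :
    greenConst * w x =
      ∫ y in ball (0 : EuclideanSpace ℝ (Fin 4)) 1, green x y * laplacian (laplacian w) y := by
  have hc : Continuous (laplacian (laplacian w)) := by
    rw [continuous_iff_continuousAt]
    intro y
    have h : ContDiffAt ℝ 2 (laplacian w) y := hw.contDiffAt.laplacian (by norm_num)
    exact (h.laplacian (m := 0) (by norm_num)).continuousAt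
  refine tendsto_nhds_unique (tendsto_integral_bubble hx hw.continuous) ?_
  refine (tendsto_integral_greenReg hx hc).congr' ?_
  filter_upwards [eventually_small] with ε hε
  exact integral_greenReg hw w0 w1 hx hε.1 (by linarith [hε.2])

end GreenFunction

section DirichletData

variable {x : EuclideanSpace ℝ (Fin 4)} {w : EuclideanSpace ℝ (Fin 4) → ℝ}

lemma fderiv_comp_norm_sq_apply_self {h : ℝ → ℝ} {h' : ℝ} (hh : HasDerivAt h h' (‖x‖ ^ 2)) :
    fderiv ℝ (fun y : EuclideanSpace ℝ (Fin 4) => h (‖y‖ ^ 2)) x x = 2 * ‖x‖ ^ 2 * h' := by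
  have h1 : HasFDerivAt (fun y : EuclideanSpace ℝ (Fin 4) => ‖y‖ ^ 2) (2 • (innerSL ℝ x)) x :=
    (hasStrictFDerivAt_norm_sq x).hasFDerivAt
  have h2 := (hh.comp_hasFDerivAt x h1).fderiv
  change fderiv ℝ (h ∘ fun y : EuclideanSpace ℝ (Fin 4) => ‖y‖ ^ 2) x x = _
  rw [h2]
  simp
  ring

lemma fderiv_apply_eq_zero_of_orthogonal (hw : DifferentiableAt ℝ w x)
    (w0 : ∀ x ∈ sphere (0 : EuclideanSpace ℝ (Fin 4)) 1, w x = 0) (hx : ‖x‖ = 1)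
    {v : EuclideanSpace ℝ (Fin 4)} (hv : ‖v‖ = 1) (hxv : inner ℝ x v = 0) :
    fderiv ℝ w x v = 0 := by
  have hγ : HasDerivAt (fun s : ℝ => cos s • x + sin s • v) v 0 := by
    exact (((hasDerivAt_cos 0).smul_const x).add ((hasDerivAt_sin 0).smul_const v)).congr_deriv
      (by simp)
  have h0 : cos (0 : ℝ) • x + sin (0 : ℝ) • v = x := by simp
  have h1 : HasDerivAt (w ∘ fun s : ℝ => cos s • x + sin s • v) (fderiv ℝ w x v) 0 := by
    refine HasFDerivAt.comp_hasDerivAt 0 ?_ hγ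
    rw [h0]; exact hw.hasFDerivAt
  have h2 : (w ∘ fun s : ℝ => cos s • x + sin s • v) = fun _ => 0 := by
    funext s
    refine w0 _ ?_
    rw [mem_sphere_zero_iff_norm]
    have : ‖cos s • x + sin s • v‖ ^ 2 = 1 := by
      rw [norm_add_sq_real, norm_smul, norm_smul, inner_smul_left, inner_smul_right, hxv, hx, hv]
      simp [cos_sq_add_sin_sq]
    exact (pow_eq_one_iff_of_nonneg (norm_nonneg _) two_ne_zero).1 this
  rw [h2] at h1
  exact h1.unique (hasDerivAt_const 0 0)

lemma fderiv_eq_zero_of_sphere (hw : DifferentiableAt ℝ w x)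
    (w0 : ∀ x ∈ sphere (0 : EuclideanSpace ℝ (Fin 4)) 1, w x = 0) (hx : ‖x‖ = 1)
    (w1 : fderiv ℝ w x x = 0) : fderiv ℝ w x = 0 := by
  ext z
  obtain ⟨r, hr⟩ : ∃ r, r = z - inner ℝ x z • x := ⟨_, rfl⟩
  have hxr : inner ℝ x r = 0 := by
    rw [hr, inner_sub_right, inner_smul_right, real_inner_self_eq_norm_sq, hx]; ring
  have hz : z = inner ℝ x z • x + r := by rw [hr]; abel
  have hr0 : fderiv ℝ w x r = 0 := by
    by_cases h : r = 0
    · rw [h, map_zero]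
    have hn : ‖r‖ ≠ 0 := norm_ne_zero_iff.2 h
    have := fderiv_apply_eq_zero_of_orthogonal hw w0 hx (v := ‖r‖⁻¹ • r)
      (by rw [norm_smul, norm_inv, norm_norm, inv_mul_cancel₀ hn])
      (by rw [inner_smul_right, hxr, mul_zero])
    rw [map_smul, smul_eq_mul] at this
    exact (mul_eq_zero.1 this).resolve_left (inv_ne_zero hn)
  rw [hz, map_add, map_smul, w1, hr0]
  simp

/-- Green representation with Dirichlet data `w = 0`, `∂_ν w = -1`. -/
lemma green_representation_of_normal (hw : ContDiff ℝ 4 w)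
    (w0 : ∀ x ∈ sphere (0 : EuclideanSpace ℝ (Fin 4)) 1, w x = 0)
    (w1 : ∀ x ∈ sphere (0 : EuclideanSpace ℝ (Fin 4)) 1, fderiv ℝ w x x = -1) (hx : ‖x‖ < 1) :
    greenConst * (w x - (1 - ‖x‖ ^ 2) / 2) =
      ∫ y in ball (0 : EuclideanSpace ℝ (Fin 4)) 1, green x y * laplacian (laplacian w) y := by
  have hq : ∀ y, quad (-(1 / 2)) 0 (1 / 2) y = (1 - ‖y‖ ^ 2) / 2 := by
    intro y; simp only [quad, inner_zero_left]; ring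
  have hv : ContDiff ℝ 4 (fun y => w y - quad (-(1 / 2)) 0 (1 / 2) y) := hw.sub contDiff_quad
  have v0 : ∀ y ∈ sphere (0 : EuclideanSpace ℝ (Fin 4)) 1,
      w y - quad (-(1 / 2)) 0 (1 / 2) y = 0 := by
    intro y hy
    rw [w0 y hy, hq, mem_sphere_zero_iff_norm.1 hy]; norm_num
  have h := green_representation hv v0 (fun y hy => ?_) hx
  · rw [hq] at h
    rw [h]
    congr 1
    funext y
    have : laplacian (fun y => w y - quad (-(1 / 2)) 0 (1 / 2) y) =
        fun y => laplacian w y - 8 * (-(1 / 2)) := by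
      funext y
      rw [laplacian_sub (hw.contDiffAt.of_le (by norm_num)) contDiff_quad.contDiffAt,
        laplacian_quad]
    rw [this, laplacian_sub (hw.contDiffAt.laplacian (by norm_num)) contDiffAt_const,
      laplacian_const, sub_zero]
  · have hy' := mem_sphere_zero_iff_norm.1 hy
    refine fderiv_eq_zero_of_sphere (hv.differentiable (by norm_num) y) v0 hy' ?_
    have e := fderiv_comp_norm_sq_apply_self (x := y) (h := fun s => (1 - s) / 2)
      (((hasDerivAt_id _).const_sub 1).div_const 2)
    rw [fderiv_fun_sub (hw.differentiable (by norm_num) y)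
      (contDiff_quad.differentiable (n := 4) (by norm_num) y)]
    change fderiv ℝ w y y - fderiv ℝ (quad (-(1 / 2)) 0 (1 / 2)) y y = 0
    rw [w1 y hy, show quad (-(1 / 2)) 0 (1 / 2) = fun y => (1 - ‖y‖ ^ 2) / 2 from funext hq, e, hy']
    norm_num

end DirichletData

section SphericalSolution

variable {x y : EuclideanSpace ℝ (Fin 4)}

lemma quad_one_eq (y : EuclideanSpace ℝ (Fin 4)) : quad 1 0 1 y = 1 + ‖y‖ ^ 2 := by
  simp only [quad, inner_zero_left]; ring

lemma quad_one_ne_zero (y : EuclideanSpace ℝ (Fin 4)) : quad 1 0 1 y ≠ 0 := by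
  rw [quad_one_eq]; positivity

/-- The spherical solution. -/
noncomputable def sphSol (x : EuclideanSpace ℝ (Fin 4)) : ℝ := log (2 / (1 + ‖x‖ ^ 2))

/-- The conformal factor comparison function. -/
noncomputable def sphFun (x : EuclideanSpace ℝ (Fin 4)) : ℝ := 2 * (1 + ‖x‖ ^ 2)⁻¹ - 1

lemma sphSol_eq : sphSol = fun y => log 2 - log (quad 1 0 1 y) := by
  funext y
  rw [sphSol, quad_one_eq, log_div two_ne_zero (by positivity)]

lemma sphFun_eq : sphFun = fun y => 2 * (quad 1 0 1 y ^ 1)⁻¹ - 1 := by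
  funext y
  rw [sphFun, quad_one_eq, pow_one]

lemma exp_sphSol (y : EuclideanSpace ℝ (Fin 4)) :
    exp (4 * sphSol y) = 16 * (quad 1 0 1 y ^ 4)⁻¹ := by
  rw [sphSol, quad_one_eq, mul_comm, exp_mul, exp_log (by positivity)]
  norm_cast
  rw [div_pow]; norm_num; rfl

lemma contDiff_sphSol {k : WithTop ℕ∞} : ContDiff ℝ k sphSol := by
  rw [sphSol_eq]
  exact contDiff_const.sub (contDiff_quad.log quad_one_ne_zero)

lemma contDiff_sphFun {k : WithTop ℕ∞} : ContDiff ℝ k sphFun := by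
  rw [sphFun_eq]
  exact (contDiff_const.mul ((contDiff_quad.pow 1).inv
    fun y => pow_ne_zero 1 (quad_one_ne_zero y))).sub contDiff_const

lemma contDiff_inv_pow_quad_one (m : ℕ) {k : WithTop ℕ∞} :
    ContDiff ℝ k fun y => (quad 1 0 1 y ^ m)⁻¹ :=
  (contDiff_quad.pow m).inv fun y => pow_ne_zero m (quad_one_ne_zero y)

lemma laplacian_laplacian_sphSol (y : EuclideanSpace ℝ (Fin 4)) :
    laplacian (laplacian sphSol) y = 6 * exp (4 * sphSol y) := by
  have h : laplacian sphSol =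
      fun y => (-4) * (quad 1 0 1 y ^ 1)⁻¹ - 4 * (quad 1 0 1 y ^ 2)⁻¹ := by
    funext y
    rw [sphSol_eq, laplacian_sub contDiffAt_const
      (contDiff_quad.contDiffAt.log (quad_one_ne_zero y)), laplacian_const,
      laplacian_log_quad (quad_one_ne_zero y)]
    simp
    ring
  rw [h, laplacian_sub (contDiff_const.mul (contDiff_inv_pow_quad_one 1)).contDiffAt
    (contDiff_const.mul (contDiff_inv_pow_quad_one 2)).contDiffAt,
    laplacian_const_mul _ (contDiff_inv_pow_quad_one 1).contDiffAt,
    laplacian_const_mul _ (contDiff_inv_pow_quad_one 2).contDiffAt,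
    laplacian_inv_pow_quad 1 (quad_one_ne_zero y), laplacian_inv_pow_quad 2 (quad_one_ne_zero y),
    exp_sphSol]
  simp
  ring

lemma laplacian_laplacian_sphFun (y : EuclideanSpace ℝ (Fin 4)) :
    laplacian (laplacian sphFun) y = 24 * exp (4 * sphSol y) * sphFun y := by
  have h : laplacian sphFun = fun y => (-16) * (quad 1 0 1 y ^ 3)⁻¹ := by
    funext y
    rw [sphFun_eq, laplacian_sub (contDiff_const.mul (contDiff_inv_pow_quad_one 1)).contDiffAt
      contDiffAt_const, laplacian_const,
      laplacian_const_mul _ (contDiff_inv_pow_quad_one 1).contDiffAt,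
      laplacian_inv_pow_quad 1 (quad_one_ne_zero y)]
    simp
    ring
  rw [h, laplacian_const_mul _ (contDiff_inv_pow_quad_one 3).contDiffAt,
    laplacian_inv_pow_quad 3 (quad_one_ne_zero y), exp_sphSol, sphFun_eq]
  have := quad_one_ne_zero y
  simp
  field_simp
  ring

lemma sphSol_sphere (hx : x ∈ sphere (0 : EuclideanSpace ℝ (Fin 4)) 1) : sphSol x = 0 := by
  rw [sphSol, mem_sphere_zero_iff_norm.1 hx]; norm_num

lemma fderiv_sphSol_sphere (hx : x ∈ sphere (0 : EuclideanSpace ℝ (Fin 4)) 1) :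
    fderiv ℝ sphSol x x = -1 := by
  have hx' := mem_sphere_zero_iff_norm.1 hx
  have h : HasDerivAt (fun s : ℝ => log 2 - log (1 + s)) (-(1 / (1 + ‖x‖ ^ 2))) (‖x‖ ^ 2) :=
    (((hasDerivAt_id _).const_add 1).log (by simp; positivity)).const_sub _
  have e := fderiv_comp_norm_sq_apply_self h
  rw [sphSol_eq]
  simp only [quad_one_eq]
  rw [e, hx']
  norm_num

lemma sphFun_sphere (hx : x ∈ sphere (0 : EuclideanSpace ℝ (Fin 4)) 1) : sphFun x = 0 := by
  rw [sphFun, mem_sphere_zero_iff_norm.1 hx]; norm_num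

lemma fderiv_sphFun_sphere (hx : x ∈ sphere (0 : EuclideanSpace ℝ (Fin 4)) 1) :
    fderiv ℝ sphFun x x = -1 := by
  have hx' := mem_sphere_zero_iff_norm.1 hx
  have h : HasDerivAt (fun s : ℝ => 2 * (1 + s)⁻¹ - 1) (2 * (-1 / (1 + ‖x‖ ^ 2) ^ 2))
      (‖x‖ ^ 2) :=
    ((((hasDerivAt_id _).const_add 1).fun_inv (by simp; positivity)).const_mul 2).sub_const 1
  have e := fderiv_comp_norm_sq_apply_self h
  change fderiv ℝ (fun x : EuclideanSpace ℝ (Fin 4) => 2 * (1 + ‖x‖ ^ 2)⁻¹ - 1) x x = _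
  rw [e, hx']
  norm_num

lemma isSol4_sphSol : IsSol4 sphSol :=
  ⟨contDiff_sphSol, fun y _ => laplacian_laplacian_sphSol y, fun _ => sphSol_sphere,
    fun _ => fderiv_sphSol_sphere⟩

end SphericalSolution

section Minimality

variable {x : EuclideanSpace ℝ (Fin 4)} {u : EuclideanSpace ℝ (Fin 4) → ℝ}

lemma IsSol4.continuous (hu : IsSol4 u) : Continuous u := hu.1.continuous

lemma IsSol4.contDiff_four (hu : IsSol4 u) : ContDiff ℝ 4 u :=
  hu.1.of_le (WithTop.coe_le_coe.2 (le_top : (4 : ℕ∞) ≤ ⊤))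

lemma IsSol4.green_representation (hu : IsSol4 u) (hx : ‖x‖ < 1) :
    greenConst * (u x - (1 - ‖x‖ ^ 2) / 2) =
      ∫ y in ball (0 : EuclideanSpace ℝ (Fin 4)) 1, green x y * (6 * exp (4 * u y)) := by
  rw [green_representation_of_normal hu.contDiff_four hu.2.2.1 hu.2.2.2 hx]
  exact setIntegral_congr_fun measurableSet_ball fun y hy => by
    simp only [hu.2.1 y hy]

lemma integral_green_sphFun (hx : ‖x‖ < 1) :
    greenConst * (sphFun x - (1 - ‖x‖ ^ 2) / 2) =
      ∫ y in ball (0 : EuclideanSpace ℝ (Fin 4)) 1,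
        green x y * (24 * exp (4 * sphSol y) * sphFun y) := by
  rw [green_representation_of_normal contDiff_sphFun (fun _ => sphFun_sphere)
    (fun _ => fderiv_sphFun_sphere) hx]
  simp only [laplacian_laplacian_sphFun]

lemma sphFun_sub_le (hx : ‖x‖ < 1) : sphFun x - (1 - ‖x‖ ^ 2) / 2 ≤ sphFun x / 2 := by
  have h : sphFun x = (1 - ‖x‖ ^ 2) / (1 + ‖x‖ ^ 2) := by
    rw [sphFun]; field_simp; ring
  have h1 : (1 - ‖x‖ ^ 2) / (1 + ‖x‖ ^ 2) ≤ 1 - ‖x‖ ^ 2 :=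
    div_le_self (by nlinarith [norm_nonneg x]) (by nlinarith [norm_nonneg x])
  rw [h]; linarith

lemma IsSol4.sub_sphSol_ge_half (hu : IsSol4 u) {M : ℝ} (hM : 0 ≤ M)
    (h : ∀ y ∈ ball (0 : EuclideanSpace ℝ (Fin 4)) 1, -M * sphFun y ≤ u y - sphSol y) :
    ∀ y ∈ ball (0 : EuclideanSpace ℝ (Fin 4)) 1, -(M / 2) * sphFun y ≤ u y - sphSol y := by
  intro x hx
  have hx := mem_ball_zero_iff.1 hx
  have hcu := hu.continuous
  have hcs : Continuous sphSol := contDiff_sphSol.continuous (n := 0)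
  have hcf : Continuous sphFun := contDiff_sphFun.continuous (n := 0)
  have e1 := hu.green_representation hx
  have e2 := isSol4_sphSol.green_representation hx
  have e3 := integral_green_sphFun hx
  have i1 := integrableOn_green_mul hx (f := fun y => 6 * exp (4 * u y)) (by fun_prop)
  have i2 := integrableOn_green_mul hx (f := fun y => 6 * exp (4 * sphSol y)) (by fun_prop)
  have i3 := integrableOn_green_mul hx (f := fun y => 24 * exp (4 * sphSol y) * sphFun y)
    (by fun_prop)
  have key : -M * (greenConst * (sphFun x - (1 - ‖x‖ ^ 2) / 2)) ≤
      greenConst * (u x - (1 - ‖x‖ ^ 2) / 2) -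
        greenConst * (sphSol x - (1 - ‖x‖ ^ 2) / 2) := by
    rw [e1, e2, e3, ← integral_sub i1 i2, ← integral_const_mul]
    refine integral_mono_ae (i3.const_mul _) (i1.sub i2) ?_
    filter_upwards [ae_ball_ne x, ae_restrict_mem measurableSet_ball] with y hy hyb
    have hg := (green_mem_Icc hx hy.1 hy.2).1
    have hexp : exp (4 * u y) = exp (4 * sphSol y) * exp (4 * (u y - sphSol y)) := by
      rw [← exp_add]; ring_nf
    have hconv := add_one_le_exp (4 * (u y - sphSol y))
    have hp := exp_pos (4 * sphSol y)
    have hb := h y hyb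
    have h1 : exp (4 * sphSol y) * (4 * (-M * sphFun y)) ≤
        exp (4 * u y) - exp (4 * sphSol y) := by
      rw [hexp]
      nlinarith
    have h2 := mul_le_mul_of_nonneg_left h1 hg
    linarith
  have hc := greenConst_pos
  have h1 : -M * (sphFun x - (1 - ‖x‖ ^ 2) / 2) ≤ u x - sphSol x := by
    refine le_of_mul_le_mul_left ?_ hc
    linarith
  nlinarith [sphFun_sub_le hx]

lemma IsSol4.sphSol_le (hu : IsSol4 u) (hx : x ∈ ball (0 : EuclideanSpace ℝ (Fin 4)) 1) :
    sphSol x ≤ u x := by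
  obtain ⟨C, hC⟩ := exists_lipschitzOnWith_closedBall (F := fun y => u y - sphSol y)
    (fun y _ => ((hu.1.of_le (by exact_mod_cast le_top)).sub contDiff_sphSol).contDiffAt)
  have hpos : ∀ y ∈ ball (0 : EuclideanSpace ℝ (Fin 4)) 1, 1 - ‖y‖ ≤ sphFun y := by
    intro y hy
    have hy := mem_ball_zero_iff.1 hy
    have h : sphFun y = (1 - ‖y‖ ^ 2) / (1 + ‖y‖ ^ 2) := by
      rw [sphFun]; field_simp; ring
    rw [h, le_div_iff₀ (by positivity)]
    have := norm_nonneg y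
    have h2 : 0 ≤ ‖y‖ * (1 - ‖y‖) ^ 2 := by positivity
    nlinarith
  have hM : ∀ k : ℕ, ∀ y ∈ ball (0 : EuclideanSpace ℝ (Fin 4)) 1,
      -(C / 2 ^ k) * sphFun y ≤ u y - sphSol y := by
    intro k
    induction k with
    | zero =>
      intro y hy
      have hy' := mem_ball_zero_iff.1 hy
      obtain ⟨p, hp, hpy⟩ : ∃ p ∈ sphere (0 : EuclideanSpace ℝ (Fin 4)) 1,
          dist y p = 1 - ‖y‖ := by
        by_cases h0 : y = 0
        · refine ⟨EuclideanSpace.single 0 1, by simp, ?_⟩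
          simp [h0]
        · have hn : ‖y‖ ≠ 0 := norm_ne_zero_iff.2 h0
          refine ⟨‖y‖⁻¹ • y, ?_, ?_⟩
          · rw [mem_sphere_zero_iff_norm, norm_smul, norm_inv, norm_norm, inv_mul_cancel₀ hn]
          · have : y - ‖y‖⁻¹ • y = (1 - ‖y‖⁻¹) • y := by rw [sub_smul, one_smul]
            rw [dist_eq_norm, this, norm_smul, Real.norm_eq_abs, abs_of_nonpos, neg_sub, sub_mul,
              inv_mul_cancel₀ hn, one_mul]
            have := (one_le_inv₀ (norm_pos_iff.2 h0)).2 hy'.le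
            linarith
      have h := hC.dist_le_mul y (ball_subset_closedBall hy) p (sphere_subset_closedBall hp)
      rw [hpy, hu.2.2.1 p hp, sphSol_sphere hp, sub_zero, dist_zero_right, Real.norm_eq_abs] at h
      have h1 := (abs_le.1 h).1
      have h2 := mul_le_mul_of_nonneg_left (hpos y hy) C.2
      simp only [pow_zero, div_one]
      change (C : ℝ) * _ ≤ (C : ℝ) * _ at h2
      linarith
    | succ k ih =>
      have := hu.sub_sphSol_ge_half (by positivity) ih
      rwa [div_div, ← pow_succ] at this
  have hlim : Filter.Tendsto (fun k : ℕ => -((C : ℝ) / 2 ^ k) * sphFun x) Filter.atTop (𝓝 0) := by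
    have h := (tendsto_const_nhds (x := (C : ℝ))).div_atTop
      (tendsto_pow_atTop_atTop_of_one_lt (one_lt_two : (1 : ℝ) < 2))
    simpa using h.neg.mul_const (sphFun x)
  have := le_of_tendsto hlim (Filter.Eventually.of_forall fun k => hM k x hx)
  linarith

end Minimality

section KernelInequalities

/-- The Green function as a function of `‖x - y‖²` and `(1 - ‖x‖²)(1 - ‖y‖²)`. -/
noncomputable def greenProfile (a b : ℝ) : ℝ := log (a + b) - log a - b * (a + b)⁻¹

lemma green_eq_greenProfile (x y : EuclideanSpace ℝ (Fin 4)) :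
    green x y = greenProfile (‖y - x‖ ^ 2) ((1 - ‖x‖ ^ 2) * (1 - ‖y‖ ^ 2)) := by
  rw [green, greenProfile, kerQ_eq]

lemma hasDerivAt_greenProfile {a b : ℝ} (ha : 0 < a) (hb : 0 ≤ b) :
    HasDerivAt (greenProfile a) (b / (a + b) ^ 2) b := by
  have hab : a + b ≠ 0 := by positivity
  have h1 : HasDerivAt (fun b => a + b) 1 b := (hasDerivAt_id b).const_add a
  have h2 := ((h1.log hab).sub_const (log a)).sub ((hasDerivAt_id b).mul (h1.fun_inv hab))
  refine h2.congr_deriv ?_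
  simp only [id]
  field_simp
  ring

lemma greenProfile_mono {a : ℝ} (ha : 0 < a) : MonotoneOn (greenProfile a) (Set.Ici 0) := by
  refine monotoneOn_of_hasDerivWithinAt_nonneg (f' := fun b => b / (a + b) ^ 2) (convex_Ici 0)
    (fun b hb => (hasDerivAt_greenProfile ha hb).continuousAt.continuousWithinAt)
    (fun b hb => ?_) fun b hb => ?_
  all_goals rw [interior_Ici] at hb
  · exact (hasDerivAt_greenProfile ha (le_of_lt hb)).hasDerivWithinAt
  · have : 0 < b := hb
    positivity

lemma greenProfile_sub_mono {a a' : ℝ} (ha : 0 < a) (haa' : a ≤ a') :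
    MonotoneOn (fun b => greenProfile a b - greenProfile a' b) (Set.Ici 0) := by
  have ha' := ha.trans_le haa'
  refine monotoneOn_of_hasDerivWithinAt_nonneg
    (f' := fun b => b / (a + b) ^ 2 - b / (a' + b) ^ 2) (convex_Ici 0)
    (fun b hb => ((hasDerivAt_greenProfile ha hb).sub
      (hasDerivAt_greenProfile ha' hb)).continuousAt.continuousWithinAt)
    (fun b hb => ?_) fun b hb => ?_
  all_goals rw [interior_Ici] at hb
  · exact ((hasDerivAt_greenProfile ha (le_of_lt hb)).sub
      (hasDerivAt_greenProfile ha' (le_of_lt hb))).hasDerivWithinAt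
  · have hb : 0 < b := hb
    rw [sub_nonneg]
    gcongr

lemma greenProfile_anti {a a' b : ℝ} (ha : 0 < a) (haa' : a ≤ a') (hb : 0 ≤ b) :
    greenProfile a' b ≤ greenProfile a b := by
  have h := greenProfile_sub_mono ha haa' (Set.mem_Ici.2 le_rfl) (Set.mem_Ici.2 hb) hb
  simp only [greenProfile, add_zero, zero_mul, sub_self] at h ⊢
  linarith

lemma greenProfile_reflection {a a' A A' B B' : ℝ} (ha : 0 < a) (haa' : a ≤ a') (hA : 0 ≤ A)
    (hAA' : A ≤ A') (hB : 0 ≤ B) (hBB' : B ≤ B') :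
    greenProfile a' (A * B') + greenProfile a (A * B) ≤
      greenProfile a (A' * B') + greenProfile a' (A' * B) := by
  have hA' := hA.trans hAA'
  have hB' := hB.trans hBB'
  have ha' := ha.trans_le haa'
  have mono : ∀ {c b b' : ℝ}, 0 < c → 0 ≤ b → b ≤ b' → greenProfile c b ≤ greenProfile c b' :=
    fun hc hb hbb' =>
      greenProfile_mono hc (Set.mem_Ici.2 hb) (Set.mem_Ici.2 (hb.trans hbb')) hbb'
  rcases le_total (A * B') (A' * B) with h | h
  · have h1 := mono ha' (by positivity) h
    have h2 := mono ha (b := A * B) (b' := A' * B') (by positivity) (by gcongr)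
    linarith
  · have h1 := mono ha (b := A * B) (b' := A' * B) (by positivity) (by gcongr)
    have h2 := mono ha (b := A * B') (b' := A' * B') (by positivity) (by gcongr)
    have h3 := greenProfile_sub_mono ha haa' (Set.mem_Ici.2 (by positivity))
      (Set.mem_Ici.2 (by positivity)) h
    simp only at h3
    linarith

end KernelInequalities

section HyperplaneReflection

variable {e x y : EuclideanSpace ℝ (Fin 4)} {l : ℝ}

/-- The reflection in the hyperplane `⟪e, x⟫ = l`, for a unit vector `e`. -/
noncomputable def hrefl (e : EuclideanSpace ℝ (Fin 4)) (l : ℝ) (x : EuclideanSpace ℝ (Fin 4)) :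
    EuclideanSpace ℝ (Fin 4) :=
  x - (2 * (inner ℝ e x - l)) • e

lemma inner_hrefl (he : ‖e‖ = 1) : inner ℝ e (hrefl e l x) = 2 * l - inner ℝ e x := by
  rw [hrefl, inner_sub_right, inner_smul_right, real_inner_self_eq_norm_sq, he]; ring

lemma hrefl_hrefl (he : ‖e‖ = 1) : hrefl e l (hrefl e l x) = x := by
  conv_lhs => rw [hrefl, inner_hrefl he]
  rw [hrefl, sub_sub, ← add_smul]
  ring_nf
  simp

lemma norm_hrefl_sq (he : ‖e‖ = 1) :
    ‖hrefl e l x‖ ^ 2 = ‖x‖ ^ 2 - 4 * l * (inner ℝ e x - l) := by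
  rw [hrefl, norm_sub_sq_real, norm_smul, inner_smul_right, he, Real.norm_eq_abs, mul_one, sq_abs,
    real_inner_comm]
  ring

lemma norm_sub_hrefl_sq (he : ‖e‖ = 1) :
    ‖y - hrefl e l x‖ ^ 2 = ‖y - x‖ ^ 2 + 4 * (inner ℝ e x - l) * (inner ℝ e y - l) := by
  have : y - hrefl e l x = (y - x) + (2 * (inner ℝ e x - l)) • e := by rw [hrefl]; abel
  rw [this, norm_add_sq_real, norm_smul, inner_smul_right, he, Real.norm_eq_abs, mul_one, sq_abs,
    real_inner_comm e (y - x), inner_sub_right]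
  ring

lemma norm_hrefl_sub_hrefl_sq (he : ‖e‖ = 1) :
    ‖hrefl e l y - hrefl e l x‖ ^ 2 = ‖y - x‖ ^ 2 := by
  rw [norm_sub_hrefl_sq he, norm_sub_rev, norm_sub_hrefl_sq he, inner_hrefl he, norm_sub_rev]
  ring

lemma continuous_hrefl : Continuous (hrefl e l) := by
  unfold hrefl
  fun_prop

lemma measurePreserving_hrefl (he : ‖e‖ = 1) : MeasurePreserving (hrefl e l) := by
  have h1 : hrefl e l = (fun y => (2 * l) • e + y) ∘ (ℝ ∙ e)ᗮ.reflection := by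
    funext x
    simp only [Function.comp_apply, Submodule.reflection_orthogonal_apply]
    rw [Submodule.reflection_singleton_apply, he, hrefl, mul_sub, sub_smul]
    simp [two_smul, two_mul, add_smul]
    abel
  rw [h1]
  exact (measurePreserving_add_left volume _).comp (LinearIsometryEquiv.measurePreserving _)

end HyperplaneReflection

section MovingPlane

variable {e x y : EuclideanSpace ℝ (Fin 4)} {l : ℝ} {u : EuclideanSpace ℝ (Fin 4) → ℝ}

lemma green_le_green_hrefl (he : ‖e‖ = 1) (hl : 0 ≤ l) (hx : ‖x‖ < 1) (hxl : l ≤ inner ℝ e x)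
    (hy : ‖y‖ < 1) (hyl : inner ℝ e y ≤ l) (hyx : y ≠ hrefl e l x) :
    green x y ≤ green (hrefl e l x) y := by
  have h0 : 0 < ‖y - hrefl e l x‖ ^ 2 := by
    have := norm_pos_iff.2 (sub_ne_zero.2 hyx); positivity
  have hB : 0 ≤ 1 - ‖y‖ ^ 2 := by nlinarith [norm_nonneg y]
  have hA : 0 ≤ 1 - ‖x‖ ^ 2 := by nlinarith [norm_nonneg x]
  have hAA' : 1 - ‖x‖ ^ 2 ≤ 1 - ‖hrefl e l x‖ ^ 2 := by
    rw [norm_hrefl_sq he]; nlinarith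
  have haa' : ‖y - hrefl e l x‖ ^ 2 ≤ ‖y - x‖ ^ 2 := by
    rw [norm_sub_hrefl_sq he]; nlinarith
  rw [green_eq_greenProfile, green_eq_greenProfile]
  refine (greenProfile_anti h0 haa' (by positivity)).trans ?_
  have : (1 - ‖x‖ ^ 2) * (1 - ‖y‖ ^ 2) ≤ (1 - ‖hrefl e l x‖ ^ 2) * (1 - ‖y‖ ^ 2) := by gcongr
  exact greenProfile_mono h0 (Set.mem_Ici.2 (by positivity))
    (Set.mem_Ici.2 (mul_nonneg (hA.trans hAA') hB)) this

lemma green_add_green_hrefl_le (he : ‖e‖ = 1) (hl : 0 ≤ l) (hx : ‖x‖ < 1)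
    (hxl : l ≤ inner ℝ e x) (hy : ‖y‖ < 1) (hyl : l ≤ inner ℝ e y) (hyx : y ≠ x) :
    green x (hrefl e l y) + green x y ≤
      green (hrefl e l x) (hrefl e l y) + green (hrefl e l x) y := by
  have h0 : 0 < ‖y - x‖ ^ 2 := by
    have := norm_pos_iff.2 (sub_ne_zero.2 hyx); positivity
  have hB : 0 ≤ 1 - ‖y‖ ^ 2 := by nlinarith [norm_nonneg y]
  have hA : 0 ≤ 1 - ‖x‖ ^ 2 := by nlinarith [norm_nonneg x]
  have hAA' : 1 - ‖x‖ ^ 2 ≤ 1 - ‖hrefl e l x‖ ^ 2 := by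
    rw [norm_hrefl_sq he]; nlinarith
  have hBB' : 1 - ‖y‖ ^ 2 ≤ 1 - ‖hrefl e l y‖ ^ 2 := by
    rw [norm_hrefl_sq he]; nlinarith
  have haa' : ‖y - x‖ ^ 2 ≤ ‖y - hrefl e l x‖ ^ 2 := by
    rw [norm_sub_hrefl_sq he]; nlinarith [mul_nonneg (sub_nonneg.2 hxl) (sub_nonneg.2 hyl)]
  have hsymm : ‖hrefl e l y - x‖ ^ 2 = ‖y - hrefl e l x‖ ^ 2 := by
    rw [norm_sub_rev, norm_sub_hrefl_sq he, norm_sub_hrefl_sq he, norm_sub_rev]; ring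
  simp only [green_eq_greenProfile, norm_hrefl_sub_hrefl_sq he, hsymm]
  exact greenProfile_reflection h0 haa' hA hAA' hB hBB'

lemma norm_hrefl_le (he : ‖e‖ = 1) (hl : 0 ≤ l) (hxl : l ≤ inner ℝ e x) :
    ‖hrefl e l x‖ ≤ ‖x‖ := by
  refine (sq_le_sq₀ (norm_nonneg _) (norm_nonneg _)).1 ?_
  rw [norm_hrefl_sq he]; nlinarith

lemma integral_green_le_integral_green_hrefl {f : EuclideanSpace ℝ (Fin 4) → ℝ}
    (hf : Continuous f) (hf0 : ∀ y, 0 ≤ f y) (he : ‖e‖ = 1) (hl : 0 ≤ l) (hx : ‖x‖ < 1)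
    (hxl : l ≤ inner ℝ e x)
    (hfl : ∀ y, ‖y‖ < 1 → l ≤ inner ℝ e y → f y ≤ f (hrefl e l y)) :
    ∫ y in ball (0 : EuclideanSpace ℝ (Fin 4)) 1, green x y * f y ≤
      ∫ y in ball (0 : EuclideanSpace ℝ (Fin 4)) 1, green (hrefl e l x) y * f y := by
  have hx' : ‖hrefl e l x‖ < 1 := (norm_hrefl_le he hl hxl).trans_lt hx
  have i1 := integrableOn_green_mul hx hf
  have i2 := integrableOn_green_mul hx' hf
  rw [← sub_nonneg, ← integral_sub i2 i1, ← integral_indicator measurableSet_ball]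
  set H : EuclideanSpace ℝ (Fin 4) → ℝ := (ball (0 : EuclideanSpace ℝ (Fin 4)) 1).indicator
    fun y => green (hrefl e l x) y * f y - green x y * f y with hH
  have i3 : Integrable H := (integrable_indicator_iff measurableSet_ball).2 (i2.sub i1)
  have hR := measurePreserving_hrefl (l := l) he
  have hemb : MeasurableEmbedding (hrefl e l) :=
    (Homeomorph.mk (Equiv.mk (hrefl e l) (hrefl e l) (fun _ => hrefl_hrefl he)
      (fun _ => hrefl_hrefl he)) continuous_hrefl continuous_hrefl).measurableEmbedding
  have e1 : ∫ y, H (hrefl e l y) = ∫ y, H y := hR.integral_comp hemb H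
  have i4 : Integrable (fun y => H (hrefl e l y)) := (hR.integrable_comp_emb hemb).2 i3
  -- the contribution of the side of the hyperplane containing the origin
  have hlow : ∀ y, inner ℝ e y ≤ l → y ≠ hrefl e l x → 0 ≤ H y := by
    intro y hyl hyx
    rw [hH]
    refine Set.indicator_apply_nonneg fun hy => ?_
    have := green_le_green_hrefl he hl hx hxl (mem_ball_zero_iff.1 hy) hyl hyx
    rw [← sub_mul]
    exact mul_nonneg (sub_nonneg.2 this) (hf0 y)
  have hcap : ∀ y, l ≤ inner ℝ e y → y ≠ x → 0 ≤ H y + H (hrefl e l y) := by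
    intro y hyl hyx
    have hyl' : inner ℝ e (hrefl e l y) ≤ l := by rw [inner_hrefl he]; linarith
    have hyx' : hrefl e l y ≠ hrefl e l x := fun h => hyx <| by
      rw [← hrefl_hrefl he (x := y) (l := l), h, hrefl_hrefl he]
    by_cases hy : y ∈ ball (0 : EuclideanSpace ℝ (Fin 4)) 1
    · have hy1 := mem_ball_zero_iff.1 hy
      have hy2 := (norm_hrefl_le he hl hyl).trans_lt hy1
      rw [hH, Set.indicator_of_mem hy, Set.indicator_of_mem (mem_ball_zero_iff.2 hy2)]
      have h1 := green_le_green_hrefl he hl hx hxl hy2 hyl' hyx'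
      have h2 := green_add_green_hrefl_le he hl hx hxl hy1 hyl hyx
      have h3 := mul_le_mul_of_nonneg_left (hfl y hy1 hyl) (sub_nonneg.2 h1)
      have h4 := mul_le_mul_of_nonneg_right h2 (hf0 y)
      linarith
    · have : H y = 0 := by rw [hH, Set.indicator_of_notMem hy]
      rw [this, zero_add]
      exact hlow _ hyl' hyx'
  have hnn : 0 ≤ ∫ y, (H y + H (hrefl e l y)) := by
    refine integral_nonneg_of_ae ?_
    filter_upwards [Measure.ae_ne volume x, Measure.ae_ne volume (hrefl e l x)] with y h1 h2
    rcases le_total l (inner ℝ e y) with h | h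
    · exact hcap y h h1
    · have := hcap (hrefl e l y) (by rw [inner_hrefl he]; linarith) fun h3 => h2 <| by
        rw [← h3, hrefl_hrefl he]
      rw [hrefl_hrefl he, add_comm] at this
      exact this
  rw [integral_add i3 i4, e1] at hnn
  linarith

lemma IsSol4.sub_hrefl_ge (hu : IsSol4 u) (he : ‖e‖ = 1) (hl : 0 ≤ l) (hx : ‖x‖ < 1)
    (hxl : l ≤ inner ℝ e x)
    (hul : ∀ y, ‖y‖ < 1 → l ≤ inner ℝ e y → u y ≤ u (hrefl e l y)) :
    2 * l * (inner ℝ e x - l) ≤ u (hrefl e l x) - u x := by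
  have hx' : ‖hrefl e l x‖ < 1 := (norm_hrefl_le he hl hxl).trans_lt hx
  have hcu := hu.continuous
  have h := integral_green_le_integral_green_hrefl (f := fun y => 6 * exp (4 * u y))
    (by fun_prop) (fun y => by positivity) he hl hx hxl (fun y hy hyl => by
      have := hul y hy hyl
      gcongr)
  rw [← hu.green_representation hx, ← hu.green_representation hx', norm_hrefl_sq he] at h
  have := le_of_mul_le_mul_left h greenConst_pos
  linarith

end MovingPlane

section RadialSymmetry

variable {e x y : EuclideanSpace ℝ (Fin 4)} {l : ℝ} {u : EuclideanSpace ℝ (Fin 4) → ℝ}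

/-- The difference quotient of `u` between `x` and its reflection, extended continuously to the
hyperplane. -/
noncomputable def reflQuot (u : EuclideanSpace ℝ (Fin 4) → ℝ) (e : EuclideanSpace ℝ (Fin 4))
    (p : ℝ × EuclideanSpace ℝ (Fin 4)) : ℝ :=
  ∫ s in (0 : ℝ)..1, -fderiv ℝ u (p.2 - (s * (2 * (inner ℝ e p.2 - p.1))) • e) e

lemma continuous_reflQuot (hu : ContDiff ℝ 1 u) : Continuous (reflQuot u e) := by
  have hc : Continuous (fderiv ℝ u) := hu.continuous_fderiv (by norm_num)
  unfold reflQuot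
  refine intervalIntegral.continuous_parametric_intervalIntegral_of_continuous' ?_ 0 1
  refine Continuous.neg (Continuous.clm_apply (hc.comp ?_) continuous_const)
  fun_prop

lemma sub_eq_mul_reflQuot (hu : ContDiff ℝ 1 u) :
    u (hrefl e l x) - u x = 2 * (inner ℝ e x - l) * reflQuot u e (l, x) := by
  have hc : Continuous (fderiv ℝ u) := hu.continuous_fderiv (by norm_num)
  have hd : ∀ s : ℝ, HasDerivAt (fun s : ℝ => u (x - (s * (2 * (inner ℝ e x - l))) • e))
      (2 * (inner ℝ e x - l) * -fderiv ℝ u (x - (s * (2 * (inner ℝ e x - l))) • e) e) s := by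
    intro s
    have h1 : HasDerivAt (fun s : ℝ => x - (s * (2 * (inner ℝ e x - l))) • e)
        (-((1 * (2 * (inner ℝ e x - l))) • e)) s :=
      (((hasDerivAt_id s).mul_const _).smul_const e).const_sub x
    have h2 := ((hu.differentiable (by norm_num)
      (x - (s * (2 * (inner ℝ e x - l))) • e)).hasFDerivAt).comp_hasDerivAt s h1
    refine h2.congr_deriv ?_
    rw [map_neg, map_smul, smul_eq_mul]; ring
  have h := intervalIntegral.integral_eq_sub_of_hasDerivAt (a := 0) (b := 1) (fun s _ => hd s)
    (Continuous.intervalIntegrable (by fun_prop) 0 1)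
  rw [intervalIntegral.integral_const_mul] at h
  rw [reflQuot, h]
  simp [hrefl]

lemma eq_of_norm_le_one_of_one_le_inner (he : ‖e‖ = 1) (hx : ‖x‖ ≤ 1) (h : 1 ≤ inner ℝ e x) :
    x = e := by
  have : ‖x - e‖ ^ 2 ≤ 0 := by
    rw [norm_sub_sq_real, he, real_inner_comm]
    nlinarith [norm_nonneg x]
  have : ‖x - e‖ = 0 := by nlinarith [norm_nonneg (x - e)]
  exact sub_eq_zero.1 (norm_eq_zero.1 this)

lemma IsSol4.contDiff_one (hu : IsSol4 u) : ContDiff ℝ 1 u :=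
  hu.contDiff_four.of_le (by norm_num)

lemma IsSol4.reflQuot_ge (hu : IsSol4 u) (he : ‖e‖ = 1) (hl : 0 < l)
    (h : ∀ y, ‖y‖ ≤ 1 → l ≤ inner ℝ e y → 0 ≤ reflQuot u e (l, y))
    (hx : ‖x‖ ≤ 1) (hxl : l ≤ inner ℝ e x) (hl1 : l < 1) : l ≤ reflQuot u e (l, x) := by
  have hul : ∀ y, ‖y‖ < 1 → l ≤ inner ℝ e y → u y ≤ u (hrefl e l y) := by
    intro y hy hyl
    have := sub_eq_mul_reflQuot (e := e) (l := l) (x := y) hu.contDiff_one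
    have h1 := mul_nonneg (mul_nonneg zero_le_two (sub_nonneg.2 hyl)) (h y hy.le hyl)
    linarith
  have hopen : ∀ y, ‖y‖ < 1 → l < inner ℝ e y → l ≤ reflQuot u e (l, y) := by
    intro y hy hyl
    have h1 := hu.sub_hrefl_ge he hl.le hy hyl.le hul
    rw [sub_eq_mul_reflQuot hu.contDiff_one] at h1
    have h2 : 0 < 2 * (inner ℝ e y - l) := by linarith
    refine le_of_mul_le_mul_left ?_ h2
    linarith
  have hcont : Continuous fun s : ℝ => reflQuot u e (l, (1 - s) • x + (s * ((1 + l) / 2)) • e) :=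
    (continuous_reflQuot hu.contDiff_one).comp (by fun_prop)
  have hlim : Filter.Tendsto (fun s : ℝ => reflQuot u e (l, (1 - s) • x + (s * ((1 + l) / 2)) • e))
      (𝓝[>] 0) (𝓝 (reflQuot u e (l, x))) := by
    have := (hcont.tendsto 0).mono_left (nhdsWithin_le_nhds (s := Set.Ioi 0))
    simpa using this
  refine ge_of_tendsto hlim ?_
  filter_upwards [Ioo_mem_nhdsGT (zero_lt_one' ℝ)] with s hs
  refine hopen _ ?_ ?_
  · have h1 : ‖(1 - s) • x‖ ≤ 1 - s := by
      rw [norm_smul, Real.norm_eq_abs, abs_of_pos (by linarith [hs.2])]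
      nlinarith [hs.2]
    have h2 : ‖(s * ((1 + l) / 2)) • e‖ = s * ((1 + l) / 2) := by
      rw [norm_smul, he, mul_one, Real.norm_eq_abs, abs_of_pos]
      have := hs.1
      positivity
    have h3 := norm_add_le ((1 - s) • x) ((s * ((1 + l) / 2)) • e)
    nlinarith [hs.1]
  · rw [inner_add_right, inner_smul_right, inner_smul_right, real_inner_self_eq_norm_sq, he]
    nlinarith [hs.1, hs.2]

lemma IsSol4.reflQuot_pos (hu : IsSol4 u) (he : ‖e‖ = 1) (hl : 0 < l) (hx : ‖x‖ ≤ 1)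
    (hxl : l ≤ inner ℝ e x) : 0 < reflQuot u e (l, x) := by
  have hcont := continuous_reflQuot (e := e) hu.contDiff_one
  by_contra! hneg
  have hle : ∀ {y : EuclideanSpace ℝ (Fin 4)}, ‖y‖ ≤ 1 → inner ℝ e y ≤ 1 := by
    intro y hy
    have := real_inner_le_norm e y
    rw [he, one_mul] at this
    exact this.trans hy
  set Z : Set (ℝ × EuclideanSpace ℝ (Fin 4)) := (Set.Icc l 1 ×ˢ closedBall 0 1) ∩
    {p | p.1 ≤ inner ℝ e p.2 ∧ reflQuot u e p ≤ 0} with hZ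
  have hZc : IsCompact Z := by
    refine (isCompact_Icc.prod (isCompact_closedBall _ _)).inter_right ?_
    have h1 : IsClosed {p : ℝ × EuclideanSpace ℝ (Fin 4) | p.1 ≤ inner ℝ e p.2} :=
      isClosed_le (by fun_prop) (by fun_prop)
    exact h1.inter (isClosed_le hcont continuous_const)
  have hZn : Z.Nonempty :=
    ⟨(l, x), ⟨⟨⟨le_rfl, hxl.trans (hle hx)⟩, by simpa using hx⟩, hxl, hneg⟩⟩
  obtain ⟨⟨m, z⟩, ⟨⟨⟨hm0, hm1⟩, hz⟩, hmz, hK⟩, hmax⟩ :=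
    hZc.exists_isMaxOn hZn continuous_fst.continuousOn
  simp only at hm0 hm1 hz hmz
  rw [mem_closedBall_zero_iff] at hz
  rcases hm1.lt_or_eq with hm1 | rfl
  · have hm : 0 < m := hl.trans_le hm0
    have hcap : ∀ y, ‖y‖ ≤ 1 → m ≤ inner ℝ e y → 0 ≤ reflQuot u e (m, y) := by
      intro y hy hym
      have hlim : Filter.Tendsto
          (fun s : ℝ => reflQuot u e ((1 - s) * m + s, (1 - s) • y + s • e))
          (𝓝[>] 0) (𝓝 (reflQuot u e (m, y))) := by
        have hc : Continuous
            fun s : ℝ => reflQuot u e ((1 - s) * m + s, (1 - s) • y + s • e) :=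
          hcont.comp (by fun_prop)
        have := (hc.tendsto 0).mono_left (nhdsWithin_le_nhds (s := Set.Ioi 0))
        simpa using this
      refine ge_of_tendsto hlim ?_
      filter_upwards [Ioo_mem_nhdsGT (zero_lt_one' ℝ)] with s hs
      by_contra! hlt
      have hnorm : ‖(1 - s) • y + s • e‖ ≤ 1 := by
        refine (norm_add_le _ _).trans ?_
        rw [norm_smul, norm_smul, he, Real.norm_eq_abs, Real.norm_eq_abs,
          abs_of_pos (by linarith [hs.2]), abs_of_pos hs.1]
        nlinarith [hs.2]
      have hinner : (1 - s) * m + s ≤ inner ℝ e ((1 - s) • y + s • e) := by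
        rw [inner_add_right, inner_smul_right, inner_smul_right, real_inner_self_eq_norm_sq, he]
        nlinarith [hs.2]
      have hmem : ((1 - s) * m + s, (1 - s) • y + s • e) ∈ Z := by
        refine ⟨⟨⟨?_, hinner.trans (hle hnorm)⟩, by simpa using hnorm⟩, hinner, hlt.le⟩
        simp only
        nlinarith [hs.1]
      have : (1 - s) * m + s ≤ m := hmax hmem
      nlinarith [hs.1]
    linarith [hu.reflQuot_ge he hm hcap hz hmz hm1]
  · have hze := eq_of_norm_le_one_of_one_le_inner he hz hmz
    have hs : fderiv ℝ u e e = -1 := hu.2.2.2 e (by simpa using he)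
    rw [hze, reflQuot] at hK
    simp only [real_inner_self_eq_norm_sq, he] at hK
    norm_num [hs] at hK

lemma IsSol4.le_hrefl_zero (hu : IsSol4 u) (he : ‖e‖ = 1) (hx : ‖x‖ ≤ 1)
    (hxe : 0 < inner ℝ e x) : u x ≤ u (hrefl e 0 x) := by
  have hc : Continuous fun l : ℝ => u (hrefl e l x) := hu.continuous.comp (by unfold hrefl; fun_prop)
  refine ge_of_tendsto ((hc.tendsto 0).mono_left (nhdsWithin_le_nhds (s := Set.Ioi 0))) ?_
  filter_upwards [Ioo_mem_nhdsGT hxe] with l hl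
  have h1 := sub_eq_mul_reflQuot (e := e) (l := l) (x := x) hu.contDiff_one
  have h2 := hu.reflQuot_pos he hl.1 hx hl.2.le
  nlinarith [hl.2]

lemma IsSol4.hrefl_zero_eq (hu : IsSol4 u) (he : ‖e‖ = 1) (hx : ‖x‖ ≤ 1)
    (hxe : 0 < inner ℝ e x) : u (hrefl e 0 x) = u x := by
  refine le_antisymm ?_ (hu.le_hrefl_zero he hx hxe)
  have he' : ‖-e‖ = 1 := by rwa [norm_neg]
  have h0 : hrefl (-e) 0 (hrefl e 0 x) = x := by
    have : ∀ y, hrefl (-e) 0 y = hrefl e 0 y := by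
      intro y; rw [hrefl, hrefl, inner_neg_left]; simp
    rw [this, hrefl_hrefl he]
  have := hu.le_hrefl_zero he' ((norm_hrefl_le he le_rfl hxe.le).trans hx)
    (by rw [inner_neg_left, inner_hrefl he]; linarith)
  rwa [h0] at this

/-- Solutions are radially symmetric. -/
theorem IsSol4.eq_of_norm_eq (hu : IsSol4 u) (hx : ‖x‖ ≤ 1) (hxy : ‖x‖ = ‖y‖) : u x = u y := by
  by_cases h : x = y
  · rw [h]
  have hn : 0 < ‖x - y‖ := norm_pos_iff.2 (sub_ne_zero.2 h)
  have h1 : 2 * inner ℝ (x - y) x = ‖x - y‖ ^ 2 := by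
    rw [inner_sub_left, real_inner_self_eq_norm_sq, norm_sub_sq_real, real_inner_comm, hxy]; ring
  have he : ‖‖x - y‖⁻¹ • (x - y)‖ = 1 := by
    rw [norm_smul, norm_inv, norm_norm, inv_mul_cancel₀ hn.ne']
  have h2 : inner ℝ (‖x - y‖⁻¹ • (x - y)) x = ‖x - y‖ / 2 := by
    rw [real_inner_smul_left]
    field_simp
    linarith
  have h3 := hu.hrefl_zero_eq he hx (by rw [h2]; positivity)
  rw [← h3]
  congr 1
  rw [hrefl, h2, smul_smul, sub_zero]
  have : 2 * (‖x - y‖ / 2) * ‖x - y‖⁻¹ = 1 := by field_simp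
  rw [this, one_smul, sub_sub_cancel]

end RadialSymmetry

section RadialProfile

variable {x : EuclideanSpace ℝ (Fin 4)} {u u₁ u₂ : EuclideanSpace ℝ (Fin 4) → ℝ} {t T : ℝ} {k : ℕ}

/-- The vector field `d/dt` in the variable `r = e^{-t}`. -/
noncomputable def eulerOp (g : ℝ → ℝ) (r : ℝ) : ℝ := -r * deriv g r

/-- The `k`-th derivative in `t` of the radial profile `t ↦ u(e^{-t} e₀)`. -/
noncomputable def radProfile (u : EuclideanSpace ℝ (Fin 4) → ℝ) (k : ℕ) (t : ℝ) : ℝ :=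
  (eulerOp^[k] fun r : ℝ => u (r • EuclideanSpace.single 0 1)) (exp (-t))

lemma contDiff_eulerOp {g : ℝ → ℝ} (hg : ContDiff ℝ (⊤ : ℕ∞) g) :
    ContDiff ℝ (⊤ : ℕ∞) (eulerOp g) :=
  contDiff_neg.mul ((contDiff_infty_iff_deriv.1 hg).2)

lemma contDiff_eulerOp_iterate (hu : ContDiff ℝ (⊤ : ℕ∞) u) (k : ℕ) :
    ContDiff ℝ (⊤ : ℕ∞) (eulerOp^[k] fun r : ℝ => u (r • EuclideanSpace.single 0 1)) := by
  induction k with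
  | zero => exact hu.comp (contDiff_id.smul contDiff_const)
  | succ k ih =>
    rw [Function.iterate_succ_apply']
    exact contDiff_eulerOp ih

lemma hasDerivAt_radProfile (hu : ContDiff ℝ (⊤ : ℕ∞) u) (k : ℕ) (t : ℝ) :
    HasDerivAt (radProfile u k) (radProfile u (k + 1) t) t := by
  have h1 : HasDerivAt (fun t : ℝ => exp (-t)) (exp (-t) * (-1)) t := (hasDerivAt_neg t).exp
  have h2 := (((contDiff_eulerOp_iterate hu k).differentiable (by simp) (exp (-t))).hasDerivAt).comp
    t h1
  refine h2.congr_deriv ?_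
  rw [radProfile, Function.iterate_succ_apply', eulerOp]
  ring

lemma continuous_radProfile (hu : ContDiff ℝ (⊤ : ℕ∞) u) (k : ℕ) : Continuous (radProfile u k) :=
  continuous_iff_continuousAt.2 fun t => (hasDerivAt_radProfile hu k t).continuousAt

lemma contDiff_radProfile (hu : ContDiff ℝ (⊤ : ℕ∞) u) (k : ℕ) :
    ContDiff ℝ (⊤ : ℕ∞) (radProfile u k) :=
  (contDiff_eulerOp_iterate hu k).comp contDiff_neg.exp

lemma tendsto_radProfile (hu : ContDiff ℝ (⊤ : ℕ∞) u) (k : ℕ) :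
    Filter.Tendsto (radProfile u k) Filter.atTop
      (𝓝 ((eulerOp^[k] fun r : ℝ => u (r • EuclideanSpace.single 0 1)) 0)) :=
  ((contDiff_eulerOp_iterate hu k).continuous.tendsto 0).comp tendsto_exp_neg_atTop_nhds_zero

lemma tendsto_radProfile_succ (hu : ContDiff ℝ (⊤ : ℕ∞) u) (k : ℕ) :
    Filter.Tendsto (radProfile u (k + 1)) Filter.atTop (𝓝 0) := by
  have := tendsto_radProfile hu (k + 1)
  rwa [Function.iterate_succ_apply', eulerOp, neg_zero, zero_mul] at this

lemma tendsto_radProfile_zero (hu : ContDiff ℝ (⊤ : ℕ∞) u) :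
    Filter.Tendsto (radProfile u 0) Filter.atTop (𝓝 (u 0)) := by
  simpa using tendsto_radProfile hu 0

lemma laplacian_comp_neg_log_norm {h h' : ℝ → ℝ} {h'' : ℝ} (hh : ContDiff ℝ 2 h)
    (hd : ∀ t, HasDerivAt h (h' t) t) (hx : x ≠ 0) (hd' : HasDerivAt h' h'' (-log ‖x‖)) :
    laplacian (fun y : EuclideanSpace ℝ (Fin 4) => h (-log ‖y‖)) x =
      exp (2 * -log ‖x‖) * (h'' - 2 * h' (-log ‖x‖)) := by
  have hn : 0 < ‖x‖ := norm_pos_iff.2 hx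
  have hq : ∀ y : EuclideanSpace ℝ (Fin 4), quad 1 0 0 y = ‖y‖ ^ 2 := by
    intro y; simp only [quad, inner_zero_left]; ring
  have hlog : ∀ y : EuclideanSpace ℝ (Fin 4), -log ‖y‖ = -(log (quad 1 0 0 y) / 2) := by
    intro y; rw [hq, log_pow]; push_cast; ring
  have hqx : 0 < quad 1 0 0 x := by rw [hq]; positivity
  have hl : ∀ {z : ℝ}, z ≠ 0 → HasDerivAt (fun z => -(log z / 2)) (-(z⁻¹ / 2)) z :=
    fun hz => ((hasDerivAt_log hz).div_const 2).neg
  have hd1 : ∀ {z : ℝ}, z ≠ 0 → HasDerivAt (fun z => h (-(log z / 2)))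
      (h' (-(log z / 2)) * -(z⁻¹ / 2)) z := fun hz => (hd _).comp _ (hl hz)
  have hd2 : HasDerivAt (fun z => h' (-(log z / 2)) * -(z⁻¹ / 2))
      (h'' * -((quad 1 0 0 x)⁻¹ / 2) * -((quad 1 0 0 x)⁻¹ / 2) +
        h' (-(log (quad 1 0 0 x) / 2)) * -(-(quad 1 0 0 x ^ 2)⁻¹ / 2)) (quad 1 0 0 x) := by
    rw [hlog] at hd'
    have h1 : HasDerivAt (fun z => h' (-(log z / 2))) (h'' * -((quad 1 0 0 x)⁻¹ / 2))
      (quad 1 0 0 x) := HasDerivAt.comp (quad 1 0 0 x) hd' (hl hqx.ne')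
    exact h1.mul ((hasDerivAt_inv hqx.ne').div_const 2).neg
  have hcd : ContDiffAt ℝ 2 (fun z => h (-(log z / 2))) (quad 1 0 0 x) :=
    hh.contDiffAt.comp _ ((contDiffAt_log.2 hqx.ne').div_const 2).neg
  simp only [hlog]
  rw [laplacian_comp_quad (h := fun z => h (-(log z / 2))) hcd
    (by filter_upwards [isOpen_ne.mem_nhds hqx.ne'] with z hz using hd1 hz) hd2]
  have hexp : exp (2 * -(log (quad 1 0 0 x) / 2)) = (quad 1 0 0 x)⁻¹ := by
    rw [show 2 * -(log (quad 1 0 0 x) / 2) = -log (quad 1 0 0 x) by ring, exp_neg, exp_log hqx]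
  rw [hexp]
  simp
  field_simp
  ring

lemma IsSol4.eq_radProfile (hu : IsSol4 u) (hx : ‖x‖ ≤ 1) (hx0 : x ≠ 0) :
    u x = radProfile u 0 (-log ‖x‖) := by
  rw [radProfile, Function.iterate_zero, id, neg_neg, exp_log (norm_pos_iff.2 hx0)]
  refine hu.eq_of_norm_eq hx ?_
  simp [norm_smul]

lemma IsSol4.laplacian_eq (hu : IsSol4 u) (hx : ‖x‖ < 1) (hx0 : x ≠ 0) :
    laplacian u x = exp (2 * -log ‖x‖) *
      (radProfile u 2 (-log ‖x‖) - 2 * radProfile u 1 (-log ‖x‖)) := by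
  have h : u =ᶠ[𝓝 x] fun y => radProfile u 0 (-log ‖y‖) := by
    filter_upwards [isOpen_ne.mem_nhds hx0, isOpen_ball.mem_nhds (mem_ball_zero_iff.2 hx)]
      with y hy0 hy using hu.eq_radProfile (mem_ball_zero_iff.1 hy).le hy0
  rw [laplacian_congr h]
  exact laplacian_comp_neg_log_norm
    ((contDiff_radProfile hu.1 0).of_le (WithTop.coe_le_coe.2 (le_top : (2 : ℕ∞) ≤ ⊤)))
    (hasDerivAt_radProfile hu.1 0) hx0 (hasDerivAt_radProfile hu.1 1 _)

lemma IsSol4.laplacian_laplacian_eq (hu : IsSol4 u) (hx : ‖x‖ < 1) (hx0 : x ≠ 0) :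
    laplacian (laplacian u) x = exp (4 * -log ‖x‖) *
      (radProfile u 4 (-log ‖x‖) - 4 * radProfile u 2 (-log ‖x‖)) := by
  have h : laplacian u =ᶠ[𝓝 x] fun y => (fun t => exp (2 * t) *
      (radProfile u 2 t - 2 * radProfile u 1 t)) (-log ‖y‖) := by
    filter_upwards [isOpen_ne.mem_nhds hx0, isOpen_ball.mem_nhds (mem_ball_zero_iff.2 hx)]
      with y hy0 hy using hu.laplacian_eq (mem_ball_zero_iff.1 hy) hy0
  have hexp : ∀ t : ℝ, HasDerivAt (fun t : ℝ => exp (2 * t)) (exp (2 * t) * 2) t := fun t => by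
    simpa using ((hasDerivAt_id t).const_mul 2).exp
  have hr := hasDerivAt_radProfile hu.1
  have hd : ∀ t : ℝ, HasDerivAt (fun t => exp (2 * t) *
      (radProfile u 2 t - 2 * radProfile u 1 t))
      (exp (2 * t) * (radProfile u 3 t - 4 * radProfile u 1 t)) t := fun t =>
    ((hexp t).mul ((hr 2 t).sub ((hr 1 t).const_mul 2))).congr_deriv (by simp only [Pi.sub_apply]; ring)
  have hd' : ∀ t : ℝ, HasDerivAt (fun t => exp (2 * t) *
      (radProfile u 3 t - 4 * radProfile u 1 t))
      (exp (2 * t) * (radProfile u 4 t + 2 * radProfile u 3 t - 4 * radProfile u 2 t -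
        8 * radProfile u 1 t)) t := fun t =>
    ((hexp t).mul ((hr 3 t).sub ((hr 1 t).const_mul 4))).congr_deriv (by simp only [Pi.sub_apply]; ring)
  have hcd : ContDiff ℝ 2 fun t => exp (2 * t) * (radProfile u 2 t - 2 * radProfile u 1 t) := by
    have hp : ∀ k, ContDiff ℝ 2 (radProfile u k) := fun k =>
      (contDiff_radProfile hu.1 k).of_le (WithTop.coe_le_coe.2 (le_top : (2 : ℕ∞) ≤ ⊤))
    exact (contDiff_const.mul contDiff_id).exp.mul ((hp 2).sub (contDiff_const.mul (hp 1)))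
  rw [laplacian_congr h, laplacian_comp_neg_log_norm hcd hd hx0 (hd' _)]
  have : exp (4 * -log ‖x‖) = exp (2 * -log ‖x‖) * exp (2 * -log ‖x‖) := by
    rw [← exp_add]; ring_nf
  rw [this]
  ring

/-- The ordinary differential equation satisfied by the radial profile. -/
lemma IsSol4.radProfile_four (hu : IsSol4 u) (ht : 0 ≤ t) :
    radProfile u 4 t = 4 * radProfile u 2 t + 6 * exp (4 * (radProfile u 0 t - t)) := by
  have hpos : ∀ s ∈ Set.Ioi (0 : ℝ),
      radProfile u 4 s = 4 * radProfile u 2 s + 6 * exp (4 * (radProfile u 0 s - s)) := by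
    intro s hs
    have hs : 0 < s := hs
    obtain ⟨x, hx⟩ : ∃ x : EuclideanSpace ℝ (Fin 4), x = exp (-s) • EuclideanSpace.single 0 1 :=
      ⟨_, rfl⟩
    have hn : ‖x‖ = exp (-s) := by rw [hx]; simp [norm_smul]
    have hn1 : ‖x‖ < 1 := by rw [hn, ← exp_zero]; exact exp_lt_exp.2 (by linarith)
    have hx0 : x ≠ 0 := by rw [← norm_pos_iff, hn]; exact exp_pos _
    have hl : -log ‖x‖ = s := by rw [hn, log_exp, neg_neg]
    have h1 := hu.laplacian_laplacian_eq hn1 hx0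
    rw [hu.2.1 x (mem_ball_zero_iff.2 hn1), hu.eq_radProfile hn1.le hx0, hl] at h1
    have h2 : exp (4 * radProfile u 0 s) = exp (4 * s) * exp (4 * (radProfile u 0 s - s)) := by
      rw [← exp_add]; ring_nf
    rw [h2] at h1
    have h3 := exp_pos (4 * s)
    have h4 : exp (4 * s) * (radProfile u 4 s) =
        exp (4 * s) * (4 * radProfile u 2 s + 6 * exp (4 * (radProfile u 0 s - s))) := by linarith
    exact mul_left_cancel₀ h3.ne' h4
  have hc := continuous_radProfile hu.1
  have hcl : IsClosed {s | radProfile u 4 s =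
      4 * radProfile u 2 s + 6 * exp (4 * (radProfile u 0 s - s))} :=
    isClosed_eq (hc 4) (((hc 2).const_mul 4).add
      (((((hc 0).sub continuous_id).const_mul 4).rexp).const_mul 6))
  have hsub := closure_minimal hpos hcl
  rw [closure_Ioi] at hsub
  exact hsub ht

lemma IsSol4.radProfile_zero_zero (hu : IsSol4 u) : radProfile u 0 0 = 0 := by
  rw [radProfile, Function.iterate_zero, id]
  refine hu.2.2.1 _ ?_
  simp

lemma IsSol4.radProfile_one_zero (hu : IsSol4 u) : radProfile u 1 0 = 1 := by
  have h1 : HasDerivAt (fun r : ℝ => r • (EuclideanSpace.single 0 1 : EuclideanSpace ℝ (Fin 4)))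
      ((1 : ℝ) • EuclideanSpace.single 0 1) 1 := (hasDerivAt_id (1 : ℝ)).smul_const _
  have h2 := ((hu.contDiff_one.differentiable (by norm_num)
    ((1 : ℝ) • EuclideanSpace.single 0 1)).hasFDerivAt).comp_hasDerivAt 1 h1
  have h3 := hu.2.2.2 ((1 : ℝ) • EuclideanSpace.single 0 1) (by simp)
  rw [h3] at h2
  rw [radProfile, Function.iterate_one, eulerOp, neg_zero, exp_zero]
  have h4 : deriv (fun r : ℝ => u (r • EuclideanSpace.single 0 1)) 1 = -1 := h2.deriv
  rw [h4]; norm_num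

/-- The first integral of the radial equation determines the second derivative at the boundary
up to sign. -/
lemma IsSol4.radProfile_two_zero_sq (hu : IsSol4 u) : radProfile u 2 0 ^ 2 = 1 := by
  obtain ⟨E, hE⟩ : ∃ E : ℝ → ℝ, E = fun t => radProfile u 3 t * (radProfile u 1 t - 1) -
      1 / 2 * radProfile u 2 t ^ 2 - 2 * (radProfile u 1 t - 1) ^ 2 -
      3 / 2 * exp (4 * (radProfile u 0 t - t)) := ⟨_, rfl⟩
  have hr := hasDerivAt_radProfile hu.1
  have hd : ∀ t, 0 ≤ t → HasDerivAt E 0 t := by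
    intro t ht
    have h1 := (hr 1 t).sub_const 1
    have h2 := (((((hr 3 t).mul h1).sub (((hr 2 t).pow 2).const_mul (1 / 2))).sub
      ((h1.pow 2).const_mul 2))).sub
      ((((hr 0 t).sub (hasDerivAt_id t)).const_mul 4).exp.const_mul (3 / 2))
    rw [hE]
    refine h2.congr_deriv ?_
    have := hu.radProfile_four ht
    simp only [Pi.sub_apply, id, zero_add] at this ⊢
    rw [this]
    ring
  have hconst : ∀ t, 0 ≤ t → E t = E 0 := by
    intro t ht
    exact constant_of_has_deriv_right_zero
      (fun s hs => (hd s hs.1).continuousAt.continuousWithinAt)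
      (fun s hs => (hd s hs.1).hasDerivWithinAt) t ⟨ht, le_rfl⟩
  have hlim : Filter.Tendsto E Filter.atTop (𝓝 (-2)) := by
    have t1 := (tendsto_radProfile_succ hu.1 0).sub_const 1
    have t2 := tendsto_radProfile_succ hu.1 1
    have t3 := tendsto_radProfile_succ hu.1 2
    have t0 : Filter.Tendsto (fun t => exp (4 * (radProfile u 0 t - t))) Filter.atTop (𝓝 0) := by
      refine tendsto_exp_atBot.comp ?_
      refine Filter.Tendsto.const_mul_atBot (by norm_num) ?_
      exact (tendsto_radProfile_zero hu.1).add_atBot Filter.tendsto_neg_atTop_atBot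
    have := (((t3.mul t1).sub ((t2.pow 2).const_mul (1 / 2))).sub ((t1.pow 2).const_mul 2)).sub
      (t0.const_mul (3 / 2))
    rw [hE]
    convert this using 2
    norm_num
  have hE0 : E 0 = -2 := by
    refine tendsto_nhds_unique ?_ hlim
    refine tendsto_const_nhds.congr' ?_
    filter_upwards [Filter.eventually_ge_atTop 0] with t ht using (hconst t ht).symm
  rw [hE] at hE0
  simp only [hu.radProfile_zero_zero, hu.radProfile_one_zero] at hE0
  norm_num at hE0
  linarith

end RadialProfile

section Uniqueness

variable {u u₁ u₂ : EuclideanSpace ℝ (Fin 4) → ℝ} {t T : ℝ}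

lemma abs_exp_sub_exp_le {a b B : ℝ} (ha : a ≤ B) (hb : b ≤ B) :
    |exp a - exp b| ≤ exp B * |a - b| := by
  wlog hab : b ≤ a generalizing a b
  · rw [abs_sub_comm, abs_sub_comm a]
    exact this hb ha (le_of_not_ge hab)
  rw [abs_of_nonneg (sub_nonneg.2 (exp_le_exp.2 hab)), abs_of_nonneg (sub_nonneg.2 hab)]
  have h1 := add_one_le_exp (b - a)
  have h2 : exp b = exp a * exp (b - a) := by rw [← exp_add]; ring_nf
  have h3 := exp_pos a
  have h4 := exp_le_exp.2 ha
  nlinarith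

lemma apply_zero_le_of_hasDerivAt_nonneg {f f' : ℝ → ℝ} (hf : ∀ t, HasDerivAt f (f' t) t)
    (hf' : ∀ t ∈ Set.Icc 0 T, 0 ≤ f' t) : ∀ t ∈ Set.Icc 0 T, f 0 ≤ f t := by
  intro t ht
  have hmono : MonotoneOn f (Set.Icc 0 T) :=
    monotoneOn_of_hasDerivWithinAt_nonneg (convex_Icc 0 T)
      (fun s _ => (hf s).continuousAt.continuousWithinAt) (fun s _ => (hf s).hasDerivWithinAt)
      fun s hs => hf' s (interior_subset hs)
  exact hmono ⟨le_rfl, ht.1.trans ht.2⟩ ht ht.1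

lemma hasDerivAt_radProfile_sub (h₁ : IsSol4 u₁) (h₂ : IsSol4 u₂) (k : ℕ) (t : ℝ) :
    HasDerivAt (fun t => radProfile u₁ k t - radProfile u₂ k t)
      (radProfile u₁ (k + 1) t - radProfile u₂ (k + 1) t) t :=
  (hasDerivAt_radProfile h₁.1 k t).sub (hasDerivAt_radProfile h₂.1 k t)

/-- As long as the third derivative of the difference of two radial profiles is nonnegative,
it stays above its initial value. -/
lemma radProfile_three_sub_ge (h₁ : IsSol4 u₁) (h₂ : IsSol4 u₂)
    (h0 : radProfile u₁ 2 0 = radProfile u₂ 2 0)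
    (h : ∀ t ∈ Set.Icc 0 T, 0 ≤ radProfile u₁ 3 t - radProfile u₂ 3 t) :
    ∀ t ∈ Set.Icc 0 T, radProfile u₁ 3 0 - radProfile u₂ 3 0 ≤
      radProfile u₁ 3 t - radProfile u₂ 3 t := by
  have hd := hasDerivAt_radProfile_sub h₁ h₂
  have z2 : ∀ t ∈ Set.Icc 0 T, 0 ≤ radProfile u₁ 2 t - radProfile u₂ 2 t := fun t ht => by
    have := apply_zero_le_of_hasDerivAt_nonneg (hd 2) h t ht
    simpa [h0] using this
  have z1 : ∀ t ∈ Set.Icc 0 T, 0 ≤ radProfile u₁ 1 t - radProfile u₂ 1 t := fun t ht => by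
    have := apply_zero_le_of_hasDerivAt_nonneg (hd 1) z2 t ht
    simpa [h₁.radProfile_one_zero, h₂.radProfile_one_zero] using this
  have z0 : ∀ t ∈ Set.Icc 0 T, 0 ≤ radProfile u₁ 0 t - radProfile u₂ 0 t := fun t ht => by
    have := apply_zero_le_of_hasDerivAt_nonneg (hd 0) z1 t ht
    simpa [h₁.radProfile_zero_zero, h₂.radProfile_zero_zero] using this
  refine apply_zero_le_of_hasDerivAt_nonneg (hd 3) fun t ht => ?_
  rw [h₁.radProfile_four ht.1, h₂.radProfile_four ht.1]
  have h1 : exp (4 * (radProfile u₂ 0 t - t)) ≤ exp (4 * (radProfile u₁ 0 t - t)) :=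
    exp_le_exp.2 (by linarith [z0 t ht])
  linarith [z2 t ht]

lemma radProfile_three_le (h₁ : IsSol4 u₁) (h₂ : IsSol4 u₂)
    (h0 : radProfile u₁ 2 0 = radProfile u₂ 2 0) : radProfile u₁ 3 0 ≤ radProfile u₂ 3 0 := by
  by_contra! hlt
  obtain ⟨z, hz⟩ : ∃ z : ℝ → ℝ, z = fun t => radProfile u₁ 3 t - radProfile u₂ 3 t := ⟨_, rfl⟩
  have hzc : Continuous z := by
    rw [hz]; exact (continuous_radProfile h₁.1 3).sub (continuous_radProfile h₂.1 3)
  have hz0 : 0 < z 0 := by rw [hz]; exact sub_pos.2 hlt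
  have hge : ∀ T, (∀ t ∈ Set.Icc 0 T, 0 ≤ z t) → ∀ t ∈ Set.Icc 0 T, z 0 ≤ z t := by
    intro T
    rw [hz]
    exact radProfile_three_sub_ge h₁ h₂ h0
  have hpos : ∀ t, 0 ≤ t → 0 ≤ z t := by
    by_contra! hneg
    obtain ⟨s, hs, hzs⟩ := hneg
    have hcpt : IsCompact (Set.Icc 0 s ∩ {t | z t ≤ 0}) :=
      isCompact_Icc.inter_right (isClosed_le hzc continuous_const)
    obtain ⟨m, ⟨hm, hzm⟩, hmin⟩ := hcpt.exists_isMinOn ⟨s, ⟨hs, le_rfl⟩, hzs.le⟩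
      continuous_id.continuousOn
    have hzm : z m ≤ 0 := hzm
    have hbefore : ∀ t ∈ Set.Ico 0 m, 0 ≤ z t := by
      intro t ht
      by_contra! hzt
      have : m ≤ t := hmin ⟨⟨ht.1, ht.2.le.trans hm.2⟩, hzt.le⟩
      exact absurd ht.2 (not_lt.2 this)
    have hm0 : 0 < m := by
      rcases hm.1.eq_or_lt with h | h
      · rw [← h] at hzm; linarith
      · exact h
    have hclosed : ∀ t ∈ Set.Icc 0 m, 0 ≤ z t := by
      have := closure_minimal (s := Set.Ico 0 m) (t := {t | 0 ≤ z t}) hbefore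
        (isClosed_le continuous_const hzc)
      rwa [closure_Ico hm0.ne] at this
    have := hge m hclosed m ⟨hm.1, le_rfl⟩
    linarith
  have hlim : Filter.Tendsto z Filter.atTop (𝓝 0) := by
    rw [hz]
    simpa using (tendsto_radProfile_succ h₁.1 2).sub (tendsto_radProfile_succ h₂.1 2)
  have : z 0 ≤ 0 := by
    refine ge_of_tendsto hlim ?_
    filter_upwards [Filter.eventually_ge_atTop 0] with t ht
    exact hge t (fun s hs => hpos s hs.1) t ⟨ht, le_rfl⟩
  linarith

lemma radProfile_eq_of_initial (h₁ : IsSol4 u₁) (h₂ : IsSol4 u₂)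
    (h2 : radProfile u₁ 2 0 = radProfile u₂ 2 0) (h3 : radProfile u₁ 3 0 = radProfile u₂ 3 0)
    (hT : 0 ≤ T) : radProfile u₁ 0 T = radProfile u₂ 0 T := by
  have hd := hasDerivAt_radProfile_sub h₁ h₂
  have hc₁ := continuous_radProfile h₁.1 0
  have hc₂ := continuous_radProfile h₂.1 0
  obtain ⟨B₁, hB₁⟩ := isCompact_Icc.bddAbove_image (K := Set.Icc 0 T)
    (f := fun t => 4 * (radProfile u₁ 0 t - t)) (by fun_prop)
  obtain ⟨B₂, hB₂⟩ := isCompact_Icc.bddAbove_image (K := Set.Icc 0 T)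
    (f := fun t => 4 * (radProfile u₂ 0 t - t)) (by fun_prop)
  obtain ⟨z, hz⟩ : ∃ z : ℕ → ℝ → ℝ, z = fun k t => radProfile u₁ k t - radProfile u₂ k t :=
    ⟨_, rfl⟩
  have hdz : ∀ k t, HasDerivAt (z k) (z (k + 1) t) t := by rw [hz]; exact hd
  obtain ⟨M, hM⟩ : ∃ M, M = exp (max B₁ B₂) := ⟨_, rfl⟩
  have hM0 : 0 < M := by rw [hM]; exact exp_pos _
  have hz4 : ∀ t ∈ Set.Icc 0 T, |z 4 t| ≤ 4 * |z 2 t| + 24 * M * |z 0 t| := by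
    intro t ht
    have e1 := h₁.radProfile_four ht.1
    have e2 := h₂.radProfile_four ht.1
    have hb := abs_exp_sub_exp_le
      ((hB₁ ⟨t, ht, rfl⟩).trans (le_max_left B₁ B₂)) ((hB₂ ⟨t, ht, rfl⟩).trans (le_max_right B₁ B₂))
    have e3 : 4 * (radProfile u₁ 0 t - t) - 4 * (radProfile u₂ 0 t - t) = 4 * z 0 t := by
      rw [hz]; ring
    simp only at hb
    rw [e3, abs_mul, abs_of_pos (by norm_num : (0 : ℝ) < 4), ← hM] at hb
    have e4 : z 4 t = 4 * z 2 t + 6 * (exp (4 * (radProfile u₁ 0 t - t)) -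
        exp (4 * (radProfile u₂ 0 t - t))) := by
      rw [hz]; simp only; rw [e1, e2]; ring
    rw [e4]
    refine (abs_add_le _ _).trans ?_
    rw [abs_mul, abs_mul, abs_of_pos (by norm_num : (0 : ℝ) < 4),
      abs_of_pos (by norm_num : (0 : ℝ) < 6)]
    linarith
  have hF : ∀ t, HasDerivAt (fun t => (z 0 t, z 1 t, z 2 t, z 3 t))
      (z 1 t, z 2 t, z 3 t, z 4 t) t := fun t =>
    (hdz 0 t).prodMk ((hdz 1 t).prodMk ((hdz 2 t).prodMk (hdz 3 t)))
  have key := eq_zero_of_abs_deriv_le_mul_abs_self_of_eq_zero_right (a := 0) (b := T)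
    (K := 4 + 24 * M) (f := fun t => (z 0 t, z 1 t, z 2 t, z 3 t))
    (fun t _ => (hF t).continuousAt.continuousWithinAt) (fun t _ => (hF t).hasDerivWithinAt)
    (by
      rw [hz]
      simp [h₁.radProfile_zero_zero, h₂.radProfile_zero_zero, h₁.radProfile_one_zero,
        h₂.radProfile_one_zero, h2, h3])
    (fun t ht => by
      have h4 := hz4 t ⟨ht.1, ht.2.le⟩
      simp only [Prod.norm_def, Real.norm_eq_abs]
      obtain ⟨N, hN⟩ : ∃ N, N = max |z 0 t| (max |z 1 t| (max |z 2 t| |z 3 t|)) := ⟨_, rfl⟩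
      have n0 : |z 0 t| ≤ N := by rw [hN]; simp
      have n1 : |z 1 t| ≤ N := by rw [hN]; simp
      have n2 : |z 2 t| ≤ N := by rw [hN]; simp
      have n3 : |z 3 t| ≤ N := by rw [hN]; simp
      rw [← hN]
      have hN0 : 0 ≤ N := (abs_nonneg _).trans n0
      have hMN : 0 ≤ M * N := by positivity
      have h5 := mul_le_mul_of_nonneg_left n0 hM0.le
      refine max_le ?_ (max_le ?_ (max_le ?_ ?_)) <;> nlinarith)
  have := key T ⟨hT, le_rfl⟩
  have h0 : z 0 T = 0 := congrArg Prod.fst this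
  rw [hz] at h0
  exact sub_eq_zero.1 h0

/-- A solution is determined by the second derivative of its profile at the boundary. -/
lemma IsSol4.eqOn_of_radProfile_two (h₁ : IsSol4 u₁) (h₂ : IsSol4 u₂)
    (h : radProfile u₁ 2 0 = radProfile u₂ 2 0) :
    ∀ x ∈ closedBall (0 : EuclideanSpace ℝ (Fin 4)) 1, u₁ x = u₂ x := by
  have h3 : radProfile u₁ 3 0 = radProfile u₂ 3 0 :=
    le_antisymm (radProfile_three_le h₁ h₂ h) (radProfile_three_le h₂ h₁ h.symm)
  have heq : ∀ t, 0 ≤ t → radProfile u₁ 0 t = radProfile u₂ 0 t :=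
    fun t ht => radProfile_eq_of_initial h₁ h₂ h h3 ht
  intro x hx
  have hx := mem_closedBall_zero_iff.1 hx
  by_cases hx0 : x = 0
  · rw [hx0]
    refine tendsto_nhds_unique (tendsto_radProfile_zero h₁.1)
      ((tendsto_radProfile_zero h₂.1).congr' ?_)
    filter_upwards [Filter.eventually_ge_atTop 0] with t ht using (heq t ht).symm
  · rw [h₁.eq_radProfile hx hx0, h₂.eq_radProfile hx hx0]
    exact heq _ (neg_nonneg.2 (log_nonpos (norm_nonneg x) hx))

end Uniqueness

/-- Proposition 3.4 of the paper: there are at most two solutions, and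
`u_s(x) = ln(2/(1+|x|²))` is the minimal solution. -/
theorem stmt_17 :
    (∀ u₁ u₂ u₃ : EuclideanSpace ℝ (Fin 4) → ℝ,
      IsSol4 u₁ → IsSol4 u₂ → IsSol4 u₃ →
      (∀ x ∈ closedBall (0 : EuclideanSpace ℝ (Fin 4)) 1, u₁ x = u₂ x) ∨
      (∀ x ∈ closedBall (0 : EuclideanSpace ℝ (Fin 4)) 1, u₁ x = u₃ x) ∨
      (∀ x ∈ closedBall (0 : EuclideanSpace ℝ (Fin 4)) 1, u₂ x = u₃ x)) ∧
    IsSol4 (fun x => Real.log (2 / (1 + ‖x‖ ^ 2))) ∧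
    (∀ u : EuclideanSpace ℝ (Fin 4) → ℝ, IsSol4 u →
      ∀ x ∈ ball (0 : EuclideanSpace ℝ (Fin 4)) 1,
        u x ≥ Real.log (2 / (1 + ‖x‖ ^ 2))) := by
  refine ⟨fun u₁ u₂ u₃ h₁ h₂ h₃ => ?_, isSol4_sphSol, fun u hu x hx => hu.sphSol_le hx⟩
  rcases sq_eq_one_iff.1 h₁.radProfile_two_zero_sq with e₁ | e₁ <;>
  rcases sq_eq_one_iff.1 h₂.radProfile_two_zero_sq with e₂ | e₂ <;>
  rcases sq_eq_one_iff.1 h₃.radProfile_two_zero_sq with e₃ | e₃ <;>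
  first
  | exact Or.inl (h₁.eqOn_of_radProfile_two h₂ (e₁.trans e₂.symm))
  | exact Or.inr (Or.inl (h₁.eqOn_of_radProfile_two h₃ (e₁.trans e₃.symm)))
  | exact Or.inr (Or.inr (h₂.eqOn_of_radProfile_two h₃ (e₂.trans e₃.symm)))
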